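/- arXiv:1109.5258 — 2 statements merged into one kernel-verified Lean document; each statement's English description precedes it below -/
import Mathlib

section
/- Let N ≥ 2 and let W(x) = k(|x|) be a radially symmetric potential of class C³ on ℝ^N∖{0}. Suppose ΔW(x) = k''(|x|) + (N−1)k'(|x|)/|x| is negative in a punctured neighborhood of the origin, that k' is locally integrable on hypersurfaces, but that ΔW is NOT locally integrable on hypersurfaces. Then for every R > 0, the partial derivative ∂₁ω(r,η) (which exists for r ≠ η since W is C³ off the origin) tends to +∞ as (r,η) → (R,R) with r ≠ η. -/
open MeasureTheory Metric Set Filter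
open scoped Topology RealInnerProductSpace

noncomputable section

/-- Euclidean space ℝ^N. -/
abbrev Euc (N : ℕ) := EuclideanSpace ℝ (Fin N)

/-- The first standard basis vector of ℝ^N. -/
def e1 (N : ℕ) (hN : 0 < N) : Euc N := EuclideanSpace.single ⟨0, hN⟩ 1

/-- σ_N, the surface area of the unit sphere in ℝ^N. -/
def sphereArea (N : ℕ) : ℝ :=
  (μH[(N : ℝ) - 1] (sphere (0 : Euc N) 1)).toReal

/-- ω(r,η) = −(1/σ_N) ∫_{∂B(0,1)} ∇W(r e₁ − η y)·e₁ dσ(y). -/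
def omegaFun (N : ℕ) (hN : 0 < N) (W : Euc N → ℝ) (r η : ℝ) : ℝ :=
  -(sphereArea N)⁻¹ *
    ∫ y in sphere (0 : Euc N) 1, ⟪gradient W (r • e1 N hN - η • y), e1 N hN⟫ ∂(μH[(N : ℝ) - 1])

/-- A radial profile g is locally integrable on hypersurfaces if ∫₀¹ |g(r)| r^{N−2} dr < ∞. -/
def LocIntOnHyp (N : ℕ) (g : ℝ → ℝ) : Prop :=
  IntegrableOn (fun r => |g r| * r ^ (N - 2)) (Ioo (0:ℝ) 1)

section Chart

variable {E : Type*} [NormedAddCommGroup E] [InnerProductSpace ℝ E] {e : E}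

/-- The point of the unit sphere at chordal distance `‖w‖` from the pole `e`, in the direction of
the tangent vector `w`. -/
def chordChart (e : E) (w : (ℝ ∙ e)ᗮ) : E :=
  (1 - ‖w‖ ^ 2 / 2) • e + √(1 - ‖w‖ ^ 2 / 4) • (w : E)

/-- The inverse of `chordChart e`. -/
def chordChartInv (e y : E) : (ℝ ∙ e)ᗮ :=
  √(2 / (1 + ⟪e, y⟫)) • (ℝ ∙ e)ᗮ.orthogonalProjectionOnto y

lemma inner_pole_coe (w : (ℝ ∙ e)ᗮ) : ⟪e, (w : E)⟫ = 0 :=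
  Submodule.mem_orthogonal_singleton_iff_inner_right.1 w.2

lemma norm_chordChart (he : ‖e‖ = 1) {w : (ℝ ∙ e)ᗮ} (hw : ‖w‖ ≤ 2) :
    ‖chordChart e w‖ = 1 := by
  have h0 : 0 ≤ 1 - ‖w‖ ^ 2 / 4 := by nlinarith [norm_nonneg w]
  have h : ‖chordChart e w‖ ^ 2 = 1 := by
    rw [chordChart, norm_add_sq_real, inner_smul_left, inner_smul_right, inner_pole_coe,
      norm_smul, norm_smul, he, mul_pow, mul_pow, Real.norm_eq_abs, Real.norm_eq_abs, sq_abs,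
      sq_abs, Real.sq_sqrt h0, Submodule.coe_norm]
    ring
  nlinarith [norm_nonneg (chordChart e w)]

lemma inner_chordChart (he : ‖e‖ = 1) (w : (ℝ ∙ e)ᗮ) :
    ⟪e, chordChart e w⟫ = 1 - ‖w‖ ^ 2 / 2 := by
  simp [chordChart, inner_add_right, inner_smul_right, inner_pole_coe, he]

lemma norm_sub_sq_of_unit (he : ‖e‖ = 1) {y : E} (hy : ‖y‖ = 1) :
    ‖y - e‖ ^ 2 = 2 * (1 - ⟪e, y⟫) := by
  rw [norm_sub_sq_real, hy, he, real_inner_comm]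
  ring

lemma norm_chordChart_sub (he : ‖e‖ = 1) {w : (ℝ ∙ e)ᗮ} (hw : ‖w‖ ≤ 2) :
    ‖chordChart e w - e‖ = ‖w‖ := by
  have h := norm_sub_sq_of_unit he (norm_chordChart he hw)
  rw [inner_chordChart he] at h
  exact (sq_eq_sq₀ (norm_nonneg _) (norm_nonneg _)).1 (by rw [h]; ring)

lemma chordChartInv_chordChart (he : ‖e‖ = 1) {w : (ℝ ∙ e)ᗮ} (hw : ‖w‖ < 2) :
    chordChartInv e (chordChart e w) = w := by
  have h0 : 0 < 1 - ‖w‖ ^ 2 / 4 := by nlinarith [norm_nonneg w]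
  rw [chordChartInv, inner_chordChart he, chordChart, map_add, map_smul, map_smul,
    Submodule.orthogonalProjectionOnto_orthogonalComplement_singleton_eq_zero,
    Submodule.orthogonalProjectionOnto_mem_subspace_eq_self, smul_zero, zero_add, smul_smul,
    ← Real.sqrt_mul' _ h0.le]
  have : 2 / (1 + (1 - ‖w‖ ^ 2 / 2)) * (1 - ‖w‖ ^ 2 / 4) = 1 := by
    have : (1 + (1 - ‖w‖ ^ 2 / 2)) ≠ 0 := by nlinarith
    rw [div_mul_eq_mul_div, div_eq_one_iff_eq this]
    ring
  rw [this, Real.sqrt_one, one_smul]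

lemma coe_orthogonalProjection_pole (he : ‖e‖ = 1) (y : E) :
    ((ℝ ∙ e)ᗮ.orthogonalProjectionOnto y : E) = y - ⟪e, y⟫ • e := by
  have h := Submodule.starProjection_orthogonal_val (K := ℝ ∙ e) y
  rw [Submodule.starProjection_singleton] at h
  simpa [he] using h

lemma norm_chordChartInv (he : ‖e‖ = 1) {y : E} (hy : ‖y‖ = 1) (h : -1 < ⟪e, y⟫) :
    ‖chordChartInv e y‖ = ‖y - e‖ := by
  have h1 : 0 < 1 + ⟪e, y⟫ := by linarith
  refine (sq_eq_sq₀ (norm_nonneg _) (norm_nonneg _)).1 ?_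
  rw [norm_sub_sq_of_unit he hy, chordChartInv, norm_smul, mul_pow, Real.norm_eq_abs, sq_abs,
    Real.sq_sqrt (by positivity), Submodule.coe_norm, coe_orthogonalProjection_pole he,
    norm_sub_sq_real, inner_smul_right, norm_smul, hy, he, real_inner_comm e y, mul_pow,
    Real.norm_eq_abs, sq_abs]
  field_simp
  ring

lemma chordChart_chordChartInv (he : ‖e‖ = 1) {y : E} (hy : ‖y‖ = 1) (h : -1 < ⟪e, y⟫) :
    chordChart e (chordChartInv e y) = y := by
  have h1 : 0 < 1 + ⟪e, y⟫ := by linarith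
  rw [chordChart, norm_chordChartInv he hy h, norm_sub_sq_of_unit he hy, chordChartInv,
    Submodule.coe_smul, coe_orthogonalProjection_pole he, smul_smul,
    ← Real.sqrt_mul' _ (by positivity)]
  have : (1 - 2 * (1 - ⟪e, y⟫) / 4) * (2 / (1 + ⟪e, y⟫)) = 1 := by
    field_simp
    ring
  rw [this, Real.sqrt_one, one_smul]
  module

lemma contDiffAt_chordChart (e : E) : ContDiffAt ℝ 1 (chordChart e) 0 := by
  have h1 : ContDiff ℝ 1 (fun w : (ℝ ∙ e)ᗮ => ‖w‖ ^ 2) := contDiff_norm_sq ℝ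
  have h2 : ContDiff ℝ 1 (fun w : (ℝ ∙ e)ᗮ => (w : E)) := (ℝ ∙ e)ᗮ.subtypeL.contDiff
  unfold chordChart
  refine ContDiffAt.add ?_ (ContDiffAt.smul ?_ h2.contDiffAt)
  · exact ((contDiff_const.sub (h1.div_const 2)).smul contDiff_const).contDiffAt
  · exact ((contDiff_const.sub (h1.div_const 4)).contDiffAt).sqrt (by simp)

lemma contDiffAt_chordChartInv (he : ‖e‖ = 1) : ContDiffAt ℝ 1 (chordChartInv e) e := by
  have h1 : ContDiff ℝ 1 (fun y : E => 1 + ⟪e, y⟫) :=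
    contDiff_const.add (contDiff_const.inner ℝ contDiff_id)
  have h2 : 1 + ⟪e, e⟫ ≠ 0 := by simp [he]
  unfold chordChartInv
  refine ContDiffAt.fun_smul ?_ (ℝ ∙ e)ᗮ.orthogonalProjectionOnto.contDiff.contDiffAt
  exact (contDiffAt_const.div h1.contDiffAt h2).sqrt (by simp [he])

/-- Near a pole the chordal chart is bi-Lipschitz. -/
lemma exists_lipschitzOnWith_chordChart (he : ‖e‖ = 1) :
    ∃ κ : ℝ, ∃ K L : NNReal, 0 < κ ∧ κ ≤ 1 ∧ LipschitzOnWith K (chordChart e) (ball 0 κ) ∧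
      LipschitzOnWith L (chordChartInv e) (ball e κ) := by
  obtain ⟨K, t, ht, hK⟩ := (contDiffAt_chordChart e).exists_lipschitzOnWith
  obtain ⟨L, s, hs, hL⟩ := (contDiffAt_chordChartInv he).exists_lipschitzOnWith
  obtain ⟨a, ha, hat⟩ := Metric.mem_nhds_iff.1 ht
  obtain ⟨b, hb, hbs⟩ := Metric.mem_nhds_iff.1 hs
  refine ⟨min 1 (min a b), K, L, by positivity, min_le_left _ _, hK.mono ?_, hL.mono ?_⟩
  · exact (ball_subset_ball (by simp)).trans hat
  · exact (ball_subset_ball (by simp)).trans hbs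

lemma neg_one_lt_inner_of_mem_ball (he : ‖e‖ = 1) {y : E} (hy : ‖y‖ = 1) {a : ℝ} (ha : a ≤ 1)
    (h : ‖y - e‖ < a) : -1 < ⟪e, y⟫ := by
  nlinarith [norm_sub_sq_of_unit he hy, norm_nonneg (y - e)]

variable [MeasurableSpace E] [BorelSpace E]

/-- Small spherical caps have at most the Hausdorff measure of a flat ball, up to a constant. -/
lemma hausdorffMeasure_sphere_inter_ball_le {n : ℕ} [FiniteDimensional ℝ E] (hn : 1 ≤ n)
    (hE : Module.finrank ℝ E = n + 1) (he : ‖e‖ = 1) :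
    ∃ κ : ℝ, ∃ C : ENNReal, 0 < κ ∧ C ≠ ⊤ ∧ ∀ a, 0 ≤ a → a ≤ κ →
      μH[(n : ℝ)] (sphere 0 1 ∩ ball e a) ≤ C * ENNReal.ofReal (a ^ n) := by
  obtain ⟨κ, K, L, hκ, hκ1, hK, -⟩ := exists_lipschitzOnWith_chordChart he
  have : Fact (Module.finrank ℝ E = n + 1) := ⟨hE⟩
  have hF : Module.finrank ℝ (ℝ ∙ e)ᗮ = n :=
    Submodule.finrank_orthogonal_span_singleton (by rintro rfl; simp at he)
  have : Nontrivial (ℝ ∙ e)ᗮ := Module.nontrivial_of_finrank_pos (R := ℝ) (by omega)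
  have hH : (μH[(n : ℝ)] : Measure (ℝ ∙ e)ᗮ).IsAddHaarMeasure := by
    have := isAddHaarMeasure_hausdorffMeasure (E := (ℝ ∙ e)ᗮ)
    rwa [hF] at this
  refine ⟨κ, (K : ENNReal) ^ (n : ℝ) * μH[(n : ℝ)] (ball (0 : (ℝ ∙ e)ᗮ) 1), hκ, ?_, ?_⟩
  · exact ENNReal.mul_ne_top (by simp) measure_ball_lt_top.ne
  · intro a ha0 ha
    have hsub : sphere 0 1 ∩ ball e a ⊆ chordChart e '' ball 0 a := by
      rintro y ⟨hy, hya⟩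
      rw [mem_sphere_zero_iff_norm] at hy
      rw [mem_ball_iff_norm] at hya
      have h := neg_one_lt_inner_of_mem_ball he hy (ha.trans hκ1) hya
      refine ⟨chordChartInv e y, ?_, chordChart_chordChartInv he hy h⟩
      rwa [mem_ball_zero_iff, norm_chordChartInv he hy h]
    calc _ ≤ μH[(n : ℝ)] (chordChart e '' ball 0 a) := measure_mono hsub
      _ ≤ (K : ENNReal) ^ (n : ℝ) * μH[(n : ℝ)] (ball (0 : (ℝ ∙ e)ᗮ) a) :=
        (hK.mono (ball_subset_ball ha)).hausdorffMeasure_image_le (by positivity)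
      _ = _ := by rw [Measure.addHaar_ball _ _ ha0, hF]; ring

/-- Unit spheres have finite Hausdorff measure in codimension one. -/
lemma hausdorffMeasure_sphere_lt_top {n : ℕ} [FiniteDimensional ℝ E] (hn : 1 ≤ n)
    (hE : Module.finrank ℝ E = n + 1) : μH[(n : ℝ)] (sphere (0 : E) 1) < ⊤ := by
  refine (isCompact_sphere (0 : E) 1).measure_lt_top_of_nhdsWithin fun e he => ?_
  obtain ⟨κ, C, hκ, hC, h⟩ := hausdorffMeasure_sphere_inter_ball_le hn hE
    (mem_sphere_zero_iff_norm.1 he)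
  refine ⟨sphere 0 1 ∩ ball e κ, inter_mem_nhdsWithin _ (ball_mem_nhds _ hκ), ?_⟩
  exact (h κ hκ.le le_rfl).trans_lt (ENNReal.mul_lt_top hC.lt_top (by simp))

/-- Spherical caps have at most the Hausdorff measure of a flat ball, up to a constant. -/
lemma exists_hausdorffMeasure_cap_le {n : ℕ} [FiniteDimensional ℝ E] (hn : 1 ≤ n)
    (hE : Module.finrank ℝ E = n + 1) (he : ‖e‖ = 1) :
    ∃ C : ENNReal, C ≠ ⊤ ∧ ∀ a, 0 ≤ a →
      μH[(n : ℝ)] (sphere 0 1 ∩ ball e a) ≤ C * ENNReal.ofReal (a ^ n) := by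
  obtain ⟨κ, C, hκ, hC, h⟩ := hausdorffMeasure_sphere_inter_ball_le hn hE he
  set D := μH[(n : ℝ)] (sphere (0 : E) 1) / ENNReal.ofReal (κ ^ n) with hD
  have hκn : ENNReal.ofReal (κ ^ n) ≠ 0 := by simpa using pow_pos hκ n
  have hD' : D ≠ ⊤ := ENNReal.div_ne_top (hausdorffMeasure_sphere_lt_top hn hE).ne hκn
  refine ⟨C + D, by simp [hC, hD'], fun a ha => ?_⟩
  rcases le_total a κ with hle | hle
  · exact (h a ha hle).trans (by gcongr; exact le_self_add)
  · calc _ ≤ μH[(n : ℝ)] (sphere (0 : E) 1) := measure_mono inter_subset_left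
      _ = D * ENNReal.ofReal (κ ^ n) := (ENNReal.div_mul_cancel hκn (by simp)).symm
      _ ≤ _ := by
        gcongr
        exact le_add_self

/-- Near a pole, surface integrals of functions of the chordal distance dominate the corresponding
flat integrals, up to a constant. -/
lemma exists_lintegral_norm_le_lintegral_sphere {n : ℕ} [FiniteDimensional ℝ E]
    (he : ‖e‖ = 1) :
    ∃ κ : ℝ, ∃ C : ENNReal, 0 < κ ∧ C ≠ ⊤ ∧ ∀ G : ℝ → ENNReal, Measurable G →
      ∫⁻ w in ball (0 : (ℝ ∙ e)ᗮ) κ, G ‖w‖ ∂μH[(n : ℝ)] ≤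
        C * ∫⁻ y in sphere 0 1, G ‖y - e‖ ∂μH[(n : ℝ)] := by
  obtain ⟨κ, K, L, hκ, hκ1, -, hL⟩ := exists_lipschitzOnWith_chordChart he
  refine ⟨κ, (L : ENNReal) ^ (n : ℝ), hκ, by simp, fun G hG => ?_⟩
  have hm : Measurable fun y : E => ‖y - e‖ := by fun_prop
  have key : ((μH[(n : ℝ)] : Measure (ℝ ∙ e)ᗮ).restrict (ball 0 κ)).map (fun w => ‖w‖) ≤
      (L : ENNReal) ^ (n : ℝ) •
        ((μH[(n : ℝ)] : Measure E).restrict (sphere 0 1)).map (fun y => ‖y - e‖) := by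
    refine Measure.le_iff.2 fun B hB => ?_
    rw [Measure.map_apply measurable_norm hB, Measure.smul_apply, Measure.map_apply hm hB,
      Measure.restrict_apply (measurable_norm hB), Measure.restrict_apply (hm hB), smul_eq_mul]
    have hsub : (fun w : (ℝ ∙ e)ᗮ => ‖w‖) ⁻¹' B ∩ ball 0 κ ⊆
        chordChartInv e '' ((fun y => ‖y - e‖) ⁻¹' B ∩ sphere 0 1 ∩ ball e κ) := by
      rintro w ⟨hwB, hw⟩
      rw [mem_ball_zero_iff] at hw
      refine ⟨chordChart e w, ⟨⟨?_, ?_⟩, ?_⟩, chordChartInv_chordChart he (by linarith)⟩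
      · rw [mem_preimage, norm_chordChart_sub he (by linarith)]
        exact hwB
      · simpa using norm_chordChart he (by linarith)
      · rwa [mem_ball_iff_norm, norm_chordChart_sub he (by linarith)]
    calc _ ≤ _ := measure_mono hsub
      _ ≤ _ := (hL.mono inter_subset_right).hausdorffMeasure_image_le (by positivity)
      _ ≤ _ := by gcongr _ * ?_; exact measure_mono inter_subset_left
  calc _ = ∫⁻ s, G s ∂((μH[(n : ℝ)] : Measure (ℝ ∙ e)ᗮ).restrict (ball 0 κ)).map (fun w => ‖w‖) :=
        (lintegral_map hG measurable_norm).symm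
    _ ≤ _ := lintegral_mono' key le_rfl
    _ = _ := by rw [lintegral_smul_measure, lintegral_map hG hm, smul_eq_mul]

end Chart

lemma integrableOn_of_isCompact_of_measure_lt_top {X : Type*} [MetricSpace X] [MeasurableSpace X]
    [BorelSpace X] {μ : Measure X} {K : Set X} (hK : IsCompact K) (hμ : μ K < ⊤) {g : X → ℝ}
    (hg : ContinuousOn g K) : IntegrableOn g K μ := by
  obtain ⟨C, hC⟩ := hK.exists_bound_of_continuousOn hg
  exact IntegrableOn.of_bound hμ (hg.aestronglyMeasurable hK.measurableSet) C
    (ae_restrict_of_forall_mem hK.measurableSet hC)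

/-- Differentiation under the integral sign over a compact set of finite measure. -/
lemma hasDerivAt_setIntegral_of_isCompact {X : Type*} [MetricSpace X]
    [MeasurableSpace X] [BorelSpace X]
    {μ : Measure X} {K : Set X} (hK : IsCompact K) (hμ : μ K < ⊤) {F F' : ℝ → X → ℝ} {x₀ ε : ℝ}
    (hε : 0 < ε)
    (hF : ContinuousOn (Function.uncurry F) (closedBall x₀ ε ×ˢ K))
    (hF' : ContinuousOn (Function.uncurry F') (closedBall x₀ ε ×ˢ K))
    (hd : ∀ x ∈ closedBall x₀ ε, ∀ y ∈ K, HasDerivAt (F · y) (F' x y) x) :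
    IntegrableOn (F' x₀) K μ ∧
      HasDerivAt (fun x => ∫ y in K, F x y ∂μ) (∫ y in K, F' x₀ y ∂μ) x₀ := by
  have hslice : ∀ {G : ℝ → X → ℝ}, ContinuousOn (Function.uncurry G) (closedBall x₀ ε ×ˢ K) →
      ∀ x ∈ closedBall x₀ ε, ContinuousOn (G x) K := fun hG x hx =>
    hG.comp (f := fun y => (x, y)) (by fun_prop) fun y hy => ⟨hx, hy⟩
  have hint : ∀ {g : X → ℝ}, ContinuousOn g K → IntegrableOn g K μ :=
    integrableOn_of_isCompact_of_measure_lt_top hK hμ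
  obtain ⟨C, hC⟩ := ((isCompact_closedBall x₀ ε).prod hK).exists_bound_of_continuousOn hF'
  have hx₀ : x₀ ∈ closedBall x₀ ε := mem_closedBall_self hε.le
  have : IsFiniteMeasure (μ.restrict K) := ⟨by simpa using hμ⟩
  refine hasDerivAt_integral_of_dominated_loc_of_deriv_le (s := closedBall x₀ ε)
    (bound := fun _ => C) (closedBall_mem_nhds _ hε) ?_ (hint (hslice hF _ hx₀))
    (hint (hslice hF' _ hx₀)).aestronglyMeasurable ?_ (integrable_const C) ?_
  · filter_upwards [closedBall_mem_nhds x₀ hε] with x hx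
    exact (hint (hslice hF _ hx)).aestronglyMeasurable
  · exact ae_restrict_of_forall_mem hK.measurableSet fun y hy x hx => hC (x, y) ⟨hx, hy⟩
  · exact ae_restrict_of_forall_mem hK.measurableSet fun y hy x hx => hd x hx y hy

section Sphere

variable {E : Type*} [NormedAddCommGroup E] [InnerProductSpace ℝ E]

lemma reflection_orthogonal_singleton_of_unit {u : E} (hu : ‖u‖ = 1) (y : E) :
    (ℝ ∙ u)ᗮ.reflection y = y - (2 * ⟪u, y⟫) • u := by
  rw [Submodule.reflection_orthogonal_apply, Submodule.reflection_singleton_apply, hu]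
  simp only [RCLike.ofReal_real_eq_id, id_eq, one_pow, div_one]
  module

variable [MeasurableSpace E] [BorelSpace E]

lemma setIntegral_sphere_comp_linearIsometryEquiv (d : ℝ) (T : E ≃ₗᵢ[ℝ] E) (f : E → ℝ) :
    ∫ y in sphere 0 1, f (T y) ∂μH[d] = ∫ y in sphere 0 1, f y ∂μH[d] := by
  have h := (T.toIsometryEquiv.measurePreserving_hausdorffMeasure d).setIntegral_preimage_emb
    T.toIsometryEquiv.toHomeomorph.measurableEmbedding f (sphere 0 1)
  have hs : T.toIsometryEquiv ⁻¹' sphere 0 1 = sphere 0 1 := by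
    ext y
    simp
  rw [hs] at h
  exact h

/-- The integral over the unit sphere of a zonal vector field rotating `v` towards `e` vanishes. -/
lemma setIntegral_sphere_rotation_eq_zero {d : ℝ} [ProperSpace E]
    (hfin : μH[d] (sphere (0 : E) 1) < ⊤) {e v : E} (he : ‖e‖ = 1) (hv : ‖v‖ = 1)
    (hev : ⟪e, v⟫ = 0) {φ φ' : ℝ → ℝ} (hφ : ∀ t ∈ Icc (-1 : ℝ) 1, HasDerivAt φ (φ' t) t)
    (hφ' : ContinuousOn φ' (Icc (-1) 1)) :
    IntegrableOn (fun y => φ' ⟪e, y⟫ * ⟪v, y⟫ ^ 2 - φ ⟪e, y⟫ * ⟪e, y⟫) (sphere 0 1) μH[d] ∧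
    ∫ y in sphere 0 1, (φ' ⟪e, y⟫ * ⟪v, y⟫ ^ 2 - φ ⟪e, y⟫ * ⟪e, y⟫) ∂μH[d] = 0 := by
  set p : ℝ → E → ℝ := fun s y => Real.cos s * ⟪v, y⟫ + Real.sin s * ⟪e, y⟫ with hp
  set p' : ℝ → E → ℝ := fun s y => -Real.sin s * ⟪v, y⟫ + Real.cos s * ⟪e, y⟫ with hp'
  set A : ℝ → E → ℝ := fun s y => ⟪e, y⟫ - 2 * p s y * Real.sin s with hA
  set B : ℝ → E → ℝ := fun s y => ⟪v, y⟫ - 2 * p s y * Real.cos s with hB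
  set F : ℝ → E → ℝ := fun s y => φ (A s y) * B s y with hF
  set A' : ℝ → E → ℝ := fun s y => -(2 * p' s y * Real.sin s + 2 * p s y * Real.cos s) with hA'
  set B' : ℝ → E → ℝ := fun s y => -(2 * p' s y * Real.cos s + 2 * p s y * -Real.sin s) with hB'
  set F' : ℝ → E → ℝ := fun s y => φ' (A s y) * A' s y * B s y + φ (A s y) * B' s y with hF'
  set u : ℝ → E := fun s => Real.cos s • v + Real.sin s • e with hu
  have hve : ⟪v, e⟫ = 0 := by rw [real_inner_comm, hev]
  have hvv : ⟪v, v⟫ = 1 := by rw [real_inner_self_eq_norm_sq, hv, one_pow]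
  have hee : ⟪e, e⟫ = 1 := by rw [real_inner_self_eq_norm_sq, he, one_pow]
  have hun : ∀ s, ‖u s‖ = 1 := by
    intro s
    have h : ‖u s‖ ^ 2 = 1 := by
      rw [← real_inner_self_eq_norm_sq]
      simp only [hu, inner_add_left, inner_add_right, inner_smul_left, inner_smul_right, hve, hev,
        hvv, hee, conj_trivial]
      nlinarith [Real.sin_sq_add_cos_sq s]
    nlinarith [norm_nonneg (u s)]
  have hpu : ∀ s y, ⟪u s, y⟫ = p s y := by
    intro s y
    simp [hu, hp, inner_add_left, inner_smul_left]
  have hAT : ∀ s y, ⟪e, (ℝ ∙ u s)ᗮ.reflection y⟫ = A s y := by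
    intro s y
    rw [reflection_orthogonal_singleton_of_unit (hun s), inner_sub_right, inner_smul_right, hpu]
    simp [hu, hA, inner_add_right, inner_smul_right, he, hev]
  have hBT : ∀ s y, ⟪v, (ℝ ∙ u s)ᗮ.reflection y⟫ = B s y := by
    intro s y
    rw [reflection_orthogonal_singleton_of_unit (hun s), inner_sub_right, inner_smul_right, hpu]
    simp [hu, hB, inner_add_right, inner_smul_right, hv, hve]
  have hA1 : ∀ s, ∀ y ∈ sphere (0 : E) 1, A s y ∈ Icc (-1 : ℝ) 1 := by
    intro s y hy
    rw [← hAT, mem_Icc, ← abs_le]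
    refine (abs_real_inner_le_norm _ _).trans ?_
    rw [he, LinearIsometryEquiv.norm_map, mem_sphere_zero_iff_norm.1 hy, one_mul]
  have hconst : ∀ s, ∫ y in sphere 0 1, F s y ∂μH[d] =
      ∫ y in sphere 0 1, φ ⟪e, y⟫ * ⟪v, y⟫ ∂μH[d] := by
    intro s
    rw [← setIntegral_sphere_comp_linearIsometryEquiv d (ℝ ∙ u s)ᗮ.reflection
      (fun y => φ ⟪e, y⟫ * ⟪v, y⟫)]
    simp only [hAT, hBT, hF]
  have hcA : Continuous (Function.uncurry A) := by
    simp only [hA, hp, Function.uncurry_def]; fun_prop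
  have hcB : Continuous (Function.uncurry B) := by
    simp only [hB, hp, Function.uncurry_def]; fun_prop
  have hcA' : Continuous (Function.uncurry A') := by
    simp only [hA', hp', hp, Function.uncurry_def]; fun_prop
  have hcB' : Continuous (Function.uncurry B') := by
    simp only [hB', hp', hp, Function.uncurry_def]; fun_prop
  have hφc : ContinuousOn φ (Icc (-1) 1) := fun t ht => (hφ t ht).continuousAt.continuousWithinAt
  have hmaps : MapsTo (Function.uncurry A) (closedBall 0 1 ×ˢ sphere (0 : E) 1) (Icc (-1) 1) :=
    fun q hq => hA1 q.1 q.2 hq.2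
  have hderiv : ∀ s, ∀ y ∈ sphere (0 : E) 1, HasDerivAt (F · y) (F' s y) s := by
    intro s y hy
    have dp : HasDerivAt (p · y) (p' s y) s :=
      ((Real.hasDerivAt_cos s).mul_const ⟪v, y⟫).add
        ((Real.hasDerivAt_sin s).mul_const ⟪e, y⟫)
    have dA : HasDerivAt (A · y) (A' s y) s :=
      (((dp.const_mul 2).mul (Real.hasDerivAt_sin s)).const_sub ⟪e, y⟫)
    have dB : HasDerivAt (B · y) (B' s y) s :=
      (((dp.const_mul 2).mul (Real.hasDerivAt_cos s)).const_sub ⟪v, y⟫)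
    exact ((hφ _ (hA1 s y hy)).comp s dA).mul dB
  obtain ⟨hint, hD⟩ := hasDerivAt_setIntegral_of_isCompact (isCompact_sphere (0 : E) 1) hfin
    (F := F) (F' := F') (x₀ := 0) one_pos
    ((hφc.comp hcA.continuousOn hmaps).mul hcB.continuousOn)
    ((((hφ'.comp hcA.continuousOn hmaps).mul hcA'.continuousOn).mul hcB.continuousOn).add
      ((hφc.comp hcA.continuousOn hmaps).mul hcB'.continuousOn))
    (fun s _ y hy => hderiv s y hy)
  simp only [hconst] at hD
  have h0 := (hasDerivAt_const (0 : ℝ) _).unique hD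
  have hF0 : F' 0 = fun y => 2 * (φ' ⟪e, y⟫ * ⟪v, y⟫ ^ 2 - φ ⟪e, y⟫ * ⟪e, y⟫) := by
    funext y
    simp only [hF', hA, hA', hB, hB', hp, hp', Real.sin_zero, Real.cos_zero, mul_zero, sub_zero,
      zero_mul, add_zero, mul_one, one_mul, neg_zero, zero_add]
    ring
  rw [hF0] at h0 hint
  rw [integral_const_mul] at h0
  refine ⟨?_, by linarith⟩
  rw [IntegrableOn]
  simpa using hint.const_mul (1 / 2)

/-- Integration by parts for zonal functions on the unit sphere. -/
lemma setIntegral_sphere_zonal_eq_zero {d : ℝ} [ProperSpace E] {ι : Type*} [Fintype ι]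
    [DecidableEq ι] (b : OrthonormalBasis ι ℝ E) (i : ι)
    (hfin : μH[d] (sphere (0 : E) 1) < ⊤) {φ φ' : ℝ → ℝ}
    (hφ : ∀ t ∈ Icc (-1 : ℝ) 1, HasDerivAt φ (φ' t) t) (hφ' : ContinuousOn φ' (Icc (-1) 1)) :
    ∫ y in sphere 0 1, (φ' ⟪b i, y⟫ * (1 - ⟪b i, y⟫ ^ 2) -
      (Fintype.card ι - 1) * (φ ⟪b i, y⟫ * ⟪b i, y⟫)) ∂μH[d] = 0 := by
  have h := fun j (hj : j ∈ Finset.univ.erase i) => setIntegral_sphere_rotation_eq_zero hfin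
    (b.norm_eq_one i) (b.norm_eq_one j) (b.inner_eq_zero (Finset.ne_of_mem_erase hj).symm) hφ hφ'
  have hsum : ∫ y in sphere 0 1, ∑ j ∈ Finset.univ.erase i,
      (φ' ⟪b i, y⟫ * ⟪b j, y⟫ ^ 2 - φ ⟪b i, y⟫ * ⟪b i, y⟫) ∂μH[d] = 0 := by
    rw [integral_finsetSum _ fun j hj => (h j hj).1]
    exact Finset.sum_eq_zero fun j hj => (h j hj).2
  rw [← hsum]
  refine setIntegral_congr_fun isClosed_sphere.measurableSet fun y hy => ?_
  have hy1 : ∑ j, ⟪b j, y⟫ ^ 2 = 1 := by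
    have := b.sum_sq_norm_inner_right y
    simpa [mem_sphere_zero_iff_norm.1 hy] using this
  rw [← Finset.add_sum_erase _ _ (Finset.mem_univ i)] at hy1
  have hc : ((Finset.univ.erase i).card : ℝ) = Fintype.card ι - 1 := by
    rw [Finset.card_erase_of_mem (Finset.mem_univ i), Finset.card_univ,
      Nat.cast_sub (Fintype.card_pos_iff.2 ⟨i⟩), Nat.cast_one]
  rw [Finset.sum_sub_distrib, ← Finset.mul_sum, Finset.sum_const, nsmul_eq_mul, hc,
    ← hy1]
  ring

/-- `setIntegral_sphere_zonal_eq_zero` about an arbitrary pole. -/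
lemma setIntegral_sphere_zonal_eq_zero_of_unit {n : ℕ} (hE : Module.finrank ℝ E = n + 1)
    {d : ℝ} [FiniteDimensional ℝ E] {e : E} (he : ‖e‖ = 1)
    (hfin : μH[d] (sphere (0 : E) 1) < ⊤) {φ φ' : ℝ → ℝ}
    (hφ : ∀ t ∈ Icc (-1 : ℝ) 1, HasDerivAt φ (φ' t) t) (hφ' : ContinuousOn φ' (Icc (-1) 1)) :
    ∫ y in sphere 0 1, (φ' ⟪e, y⟫ * (1 - ⟪e, y⟫ ^ 2) - n * (φ ⟪e, y⟫ * ⟪e, y⟫)) ∂μH[d] = 0 := by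
  have ho : Orthonormal ℝ (({0} : Set (Fin (n + 1))).domRestrict fun _ => e) :=
    ⟨fun _ => he, fun i j hij => (hij (Subsingleton.elim i j)).elim⟩
  obtain ⟨b, hb⟩ := ho.exists_orthonormalBasis_extension_of_card_eq (by simp [hE])
  have h := setIntegral_sphere_zonal_eq_zero b 0 hfin hφ hφ'
  rw [hb 0 rfl] at h
  simpa using h

end Sphere

section RadialField

variable {f f' : ℝ → ℝ}

lemma hasDerivAt_comp_sqrt_div_sqrt {x : ℝ} (hx : 0 < x) (hf : HasDerivAt f (f' √x) √x) :
    HasDerivAt (fun x => f √x / √x) ((f' √x - f √x / √x) / (2 * x)) x := by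
  have hs : 0 < √x := Real.sqrt_pos.2 hx
  have h := (hf.comp x (Real.hasDerivAt_sqrt hx.ne')).div (Real.hasDerivAt_sqrt hx.ne') hs.ne'
  refine h.congr_deriv ?_
  rw [Function.comp_apply, Real.sq_sqrt hx.le]
  field_simp

/-- The squared distance between the points `r • e` and `η • y`, where `⟪e, y⟫ = t`. -/
def chordSq (r η t : ℝ) : ℝ := r ^ 2 + η ^ 2 - 2 * r * η * t

lemma sq_sub_add_eq_chordSq (r η t : ℝ) : (r - η) ^ 2 + 2 * (r * η) * (1 - t) = chordSq r η t := by
  unfold chordSq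
  ring

lemma chordSq_pos {r η t : ℝ} (hr : 0 < r) (hη : 0 < η) (h : r ≠ η) (ht : t ≤ 1) :
    0 < chordSq r η t := by
  rw [← sq_sub_add_eq_chordSq]
  have := sub_ne_zero.2 h
  have := sub_nonneg.2 ht
  positivity

/-- The integrand, as a function of `t = ⟪e, y⟫`, of the derivative in `r` of the spherical
average of `f ‖z‖ / ‖z‖ * ⟪z, e⟫` at `z = r • e - η • y`, after an integration by parts. -/
def radialIntegrand (n : ℕ) (f f' : ℝ → ℝ) (r η t : ℝ) : ℝ :=
  (f' √(chordSq r η t) + n * f √(chordSq r η t) / √(chordSq r η t)) *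
    (1 + η * (r - η) * (1 - t ^ 2) / chordSq r η t) -
  f √(chordSq r η t) / √(chordSq r η t) *
    (n * (1 - t) + (n + 1) * (η * (r - η) * (1 - t ^ 2) / chordSq r η t))

lemma abs_theta_le {r η t : ℝ} (hr : 0 < r) (hη : 0 < η) (h : r ≠ η) (ht : t ∈ Icc (-1 : ℝ) 1) :
    |η * (r - η) * (1 - t ^ 2) / chordSq r η t| ≤ |r - η| / r := by
  have hτ := chordSq_pos hr hη h ht.2
  have h1 : 0 ≤ 1 - t ^ 2 := by nlinarith [ht.1, ht.2]
  rw [abs_div, abs_of_pos hτ, abs_mul, abs_mul, abs_of_pos hη, abs_of_nonneg h1,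
    div_le_div_iff₀ hτ hr]
  have h2 : η * (1 - t ^ 2) * r ≤ chordSq r η t := by
    rw [← sq_sub_add_eq_chordSq]
    have : 0 ≤ r * η * (1 - t) ^ 2 := by positivity
    nlinarith [sq_nonneg (r - η)]
  nlinarith [abs_nonneg (r - η)]

/-- Lower bound for the negative of `radialIntegrand` near the point `(R, R)`. -/
lemma le_neg_radialIntegrand (n : ℕ) {R C r η t : ℝ} (hR : 0 < R) (hC : 0 ≤ C)
    (hf : ∀ x ∈ Ioc 0 (4 * R), f' x + n * f x / x ≤ C)
    (hr : |r - R| < R / 4) (hη : |η - R| < R / 4) (h : r ≠ η) (ht : t ∈ Icc (-1 : ℝ) 1) :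
    1 / 3 * (C - (f' √(chordSq r η t) + n * f √(chordSq r η t) / √(chordSq r η t))) - 2 * C -
      (7 * n + 2) / R * |f √(chordSq r η t)| ≤ -radialIntegrand n f f' r η t := by
  rw [abs_lt] at hr hη
  have hr0 : 0 < r := by linarith
  have hη0 : 0 < η := by linarith
  have hθ := abs_theta_le hr0 hη0 h ht
  have hτ := chordSq_pos hr0 hη0 h ht.2
  rw [radialIntegrand]
  set θ := η * (r - η) * (1 - t ^ 2) / chordSq r η t
  have hτ2 := sq_sub_add_eq_chordSq r η t
  have hs := Real.sq_sqrt hτ.le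
  have hρ := Real.sqrt_pos.2 hτ
  set ρ := √(chordSq r η t)
  have h1t := sub_nonneg.2 ht.2
  have hrη : R ^ 2 / 2 ≤ r * η := by nlinarith
  have hsub : |r - η| ≤ R / 2 := abs_le.2 ⟨by linarith, by linarith⟩
  have hρr : |r - η| ≤ ρ := by
    refine abs_le_of_sq_le_sq ?_ hρ.le
    rw [hs, ← hτ2]
    have : 0 ≤ 2 * (r * η) * (1 - t) := by positivity
    linarith
  have hρ4 : ρ ≤ 5 / 2 * R := by
    refine abs_le_of_sq_le_sq' ?_ (by positivity) |>.2
    rw [hs, chordSq]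
    nlinarith [ht.1, mul_pos hr0 hη0]
  have hθ2 : |θ| ≤ 2 / 3 := by
    refine hθ.trans ?_
    rw [div_le_div_iff₀ hr0 (by norm_num)]
    linarith
  have hL := hf ρ ⟨hρ, by linarith⟩
  have hmain : 1 / 3 * (C - (f' ρ + n * f ρ / ρ)) - 2 * C ≤ -(f' ρ + n * f ρ / ρ) * (1 + θ) := by
    nlinarith [abs_le.1 hθ2]
  have hθρ : |θ| ≤ 2 * ρ / R := by
    refine hθ.trans ?_
    rw [div_le_div_iff₀ hr0 hR]
    nlinarith [abs_nonneg (r - η)]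
  have h1t' : 1 - t ≤ 5 * ρ / R := by
    rw [le_div_iff₀ hR]
    have h3 : R ^ 2 * (1 - t) ≤ ρ ^ 2 := by
      nlinarith [sq_nonneg (r - η)]
    have h4 : ρ ^ 2 ≤ 5 / 2 * R * ρ := by nlinarith
    have h5 : R * (R * (1 - t)) ≤ R * (5 * ρ) := by nlinarith
    exact (by linarith [le_of_mul_le_mul_left h5 hR] : (1 - t) * R ≤ 5 * ρ)
  have hrem : f ρ / ρ * (n * (1 - t) + (n + 1) * θ) ≥ -((7 * n + 2) / R * |f ρ|) := by
    refine neg_le_of_abs_le ?_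
    rw [abs_mul, abs_div, abs_of_pos hρ]
    have h6 : |n * (1 - t) + (n + 1) * θ| ≤ (7 * n + 2) / R * ρ := by
      calc |n * (1 - t) + (n + 1) * θ| ≤ |n * (1 - t)| + |(n + 1) * θ| := abs_add_le _ _
        _ = n * (1 - t) + (n + 1) * |θ| := by
          rw [abs_of_nonneg (by positivity), abs_mul, abs_of_nonneg (by positivity)]
        _ ≤ n * (5 * ρ / R) + (n + 1) * (2 * ρ / R) := by gcongr
        _ = _ := by ring
    calc _ ≤ |f ρ| / ρ * ((7 * n + 2) / R * ρ) := by gcongr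
      _ = _ := by field_simp
  linarith

variable {E : Type*} [NormedAddCommGroup E] [InnerProductSpace ℝ E]

lemma norm_smul_sub_smul_sq {e y : E} (he : ‖e‖ = 1) (hy : ‖y‖ = 1) (r η : ℝ) :
    ‖r • e - η • y‖ ^ 2 = chordSq r η ⟪e, y⟫ := by
  rw [norm_sub_sq_real, norm_smul, norm_smul, he, hy, real_inner_smul_left, real_inner_smul_right,
    chordSq, mul_one, mul_one, Real.norm_eq_abs, Real.norm_eq_abs, sq_abs, sq_abs]
  ring

lemma sqrt_chordSq_inner {e y : E} (he : ‖e‖ = 1) (hy : ‖y‖ = 1) (r η : ℝ) :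
    √(chordSq r η ⟪e, y⟫) = ‖r • e - η • y‖ := by
  rw [← norm_smul_sub_smul_sq he hy, Real.sqrt_sq (norm_nonneg _)]

lemma inner_mem_Icc_of_unit {e y : E} (he : ‖e‖ = 1) (hy : ‖y‖ = 1) :
    ⟪e, y⟫ ∈ Icc (-1 : ℝ) 1 := by
  have h := abs_real_inner_le_norm e y
  rw [he, hy, one_mul] at h
  exact abs_le.1 h

variable [MeasurableSpace E] [BorelSpace E] [FiniteDimensional ℝ E]

lemma hasDerivAt_setIntegral_sphere_radial {n : ℕ} (hE : Module.finrank ℝ E = n + 1) {d : ℝ}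
    {e : E} (he : ‖e‖ = 1) (hfin : μH[d] (sphere (0 : E) 1) < ⊤)
    (hf : ∀ x, 0 < x → HasDerivAt f (f' x) x) (hf' : ContinuousOn f' (Ioi 0))
    {r η : ℝ} (hr : 0 < r) (hη : 0 < η) (h : r ≠ η) :
    IntegrableOn (fun y => radialIntegrand n f f' r η ⟪e, y⟫) (sphere 0 1) μH[d] ∧
    HasDerivAt (fun s => ∫ y in sphere 0 1,
        f ‖s • e - η • y‖ / ‖s • e - η • y‖ * (s - η * ⟪e, y⟫) ∂μH[d])
      (∫ y in sphere 0 1, radialIntegrand n f f' r η ⟪e, y⟫ ∂μH[d]) r := by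
  set Q : ℝ → ℝ := fun x => f √x / √x with hQ
  set Q' : ℝ → ℝ := fun x => (f' √x - f √x / √x) / (2 * x) with hQ'
  have hQd : ∀ x, 0 < x → HasDerivAt Q (Q' x) x := fun x hx =>
    hasDerivAt_comp_sqrt_div_sqrt hx (hf _ (Real.sqrt_pos.2 hx))
  have hfc : ContinuousOn f (Ioi 0) := fun x hx => (hf x hx).continuousAt.continuousWithinAt
  have hQc : ContinuousOn Q (Ioi 0) := fun x hx => (hQd x hx).continuousAt.continuousWithinAt
  have hsq : MapsTo Real.sqrt (Ioi 0) (Ioi 0) := fun x hx => Real.sqrt_pos.2 hx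
  have hQ'c : ContinuousOn Q' (Ioi 0) := by
    refine ((hf'.comp Real.continuous_sqrt.continuousOn hsq).sub hQc).div (by fun_prop) ?_
    intro x hx
    have := ne_of_gt (mem_Ioi.1 hx)
    positivity
  have hin : ∀ y ∈ sphere (0 : E) 1, ⟪e, y⟫ ∈ Icc (-1 : ℝ) 1 := fun y hy =>
    inner_mem_Icc_of_unit he (mem_sphere_zero_iff_norm.1 hy)
  set ε := min (r / 2) (|r - η| / 2) with hε
  have hε0 : 0 < ε := by
    have := abs_pos.2 (sub_ne_zero.2 h)
    positivity
  have hball : ∀ s ∈ closedBall r ε, 0 < s ∧ s ≠ η := by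
    intro s hs
    rw [mem_closedBall, Real.dist_eq] at hs
    have h1 : ε ≤ r / 2 := min_le_left _ _
    have h2 : ε ≤ |r - η| / 2 := min_le_right _ _
    refine ⟨by linarith [(abs_le.1 hs).1], ?_⟩
    rintro rfl
    rw [abs_sub_comm] at hs
    linarith [abs_pos.2 (sub_ne_zero.2 h)]
  have hpos : ∀ s ∈ closedBall r ε, ∀ y ∈ sphere (0 : E) 1, 0 < chordSq s η ⟪e, y⟫ :=
    fun s hs y hy => chordSq_pos (hball s hs).1 hη (hball s hs).2 (hin y hy).2
  have hcc : Continuous fun q : ℝ × E => chordSq q.1 η ⟪e, q.2⟫ := by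
    unfold chordSq
    fun_prop
  have hmaps : MapsTo (fun q : ℝ × E => chordSq q.1 η ⟪e, q.2⟫)
      (closedBall r ε ×ˢ sphere (0 : E) 1) (Ioi 0) := fun q hq => hpos _ hq.1 _ hq.2
  have hlin : Continuous fun q : ℝ × E => q.1 - η * ⟪e, q.2⟫ := by fun_prop
  have hr' : r ∈ closedBall r ε := mem_closedBall_self hε0.le
  obtain ⟨hint, hD⟩ := hasDerivAt_setIntegral_of_isCompact (isCompact_sphere (0 : E) 1) hfin
    (F := fun s y => Q (chordSq s η ⟪e, y⟫) * (s - η * ⟪e, y⟫))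
    (F' := fun s y => Q' (chordSq s η ⟪e, y⟫) * (2 * (s - η * ⟪e, y⟫)) * (s - η * ⟪e, y⟫) +
      Q (chordSq s η ⟪e, y⟫) * 1) (x₀ := r) hε0
    ((hQc.comp hcc.continuousOn hmaps).mul hlin.continuousOn)
    ((((hQ'c.comp hcc.continuousOn hmaps).mul (hlin.const_mul 2).continuousOn).mul
      hlin.continuousOn).add ((hQc.comp hcc.continuousOn hmaps).mul
        (continuous_const (y := (1 : ℝ))).continuousOn))
    (fun s hs y hy => by
      have hc : HasDerivAt (fun s => chordSq s η ⟪e, y⟫) (2 * (s - η * ⟪e, y⟫)) s := by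
        unfold chordSq
        refine ((((hasDerivAt_id' s).pow 2).add_const (η ^ 2)).sub
          ((((hasDerivAt_id' s).const_mul 2).mul_const η).mul_const ⟪e, y⟫)).congr_deriv ?_
        simp
        ring
      exact ((hQd _ (hpos s hs y hy)).comp s hc).mul ((hasDerivAt_id' s).sub_const _))
  have hcr : Continuous fun t : ℝ => chordSq r η t := by
    unfold chordSq
    fun_prop
  have hmr : MapsTo (fun t => chordSq r η t) (Icc (-1) 1) (Ioi 0) := fun t ht =>
    chordSq_pos hr hη h ht.2
  have hφ' : ContinuousOn (fun t => Q' (chordSq r η t) * (-(2 * r * η))) (Icc (-1) 1) :=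
    (hQ'c.comp hcr.continuousOn hmr).mul continuousOn_const
  have hφc : ContinuousOn (fun t => Q (chordSq r η t)) (Icc (-1) 1) :=
    hQc.comp hcr.continuousOn hmr
  have hz := setIntegral_sphere_zonal_eq_zero_of_unit hE he hfin
    (φ := fun t => Q (chordSq r η t)) (φ' := fun t => Q' (chordSq r η t) * (-(2 * r * η)))
    (fun t ht => (hQd _ (hmr ht)).comp t (by
      unfold chordSq
      exact (((hasDerivAt_id' t).const_mul (2 * r * η)).const_sub _).congr_deriv (by simp))) hφ'
  have hzint : IntegrableOn (fun y => Q' (chordSq r η ⟪e, y⟫) * (-(2 * r * η)) * (1 - ⟪e, y⟫ ^ 2) -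
      n * (Q (chordSq r η ⟪e, y⟫) * ⟪e, y⟫)) (sphere 0 1) μH[d] := by
    refine integrableOn_of_isCompact_of_measure_lt_top (isCompact_sphere (0 : E) 1) hfin ?_
    have hi : ContinuousOn (fun y : E => ⟪e, y⟫) (sphere 0 1) := by fun_prop
    exact ((hφ'.comp hi hin).mul (by fun_prop)).sub
      (continuousOn_const.mul ((hφc.comp hi hin).mul hi))
  have heq : ∀ y ∈ sphere (0 : E) 1, Q' (chordSq r η ⟪e, y⟫) * (2 * (r - η * ⟪e, y⟫)) *
      (r - η * ⟪e, y⟫) + Q (chordSq r η ⟪e, y⟫) * 1 -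
      (Q' (chordSq r η ⟪e, y⟫) * (-(2 * r * η)) * (1 - ⟪e, y⟫ ^ 2) -
      n * (Q (chordSq r η ⟪e, y⟫) * ⟪e, y⟫)) = radialIntegrand n f f' r η ⟪e, y⟫ := by
    intro y hy
    have hp := hpos r hr' y hy
    simp only [hQ, hQ', radialIntegrand]
    generalize ⟪e, y⟫ = t at *
    have hτ : chordSq r η t = (r - η * t) ^ 2 + r * η * (1 - t ^ 2) - η * (r - η) * (1 - t ^ 2) := by
      unfold chordSq
      ring
    set ρ := √(chordSq r η t)
    have hρ : 0 < ρ := Real.sqrt_pos.2 hp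
    generalize chordSq r η t = τ at *
    generalize f ρ = a
    generalize f' ρ = b
    have hrel : (r - η * t) ^ 2 + r * η * (1 - t ^ 2) = τ + η * (r - η) * (1 - t ^ 2) := by linarith
    have hlhs : (b - a / ρ) / (2 * τ) * (2 * (r - η * t)) * (r - η * t) + a / ρ * 1 -
        ((b - a / ρ) / (2 * τ) * (-(2 * r * η)) * (1 - t ^ 2) - n * (a / ρ * t)) =
        (b - a / ρ) / τ * ((r - η * t) ^ 2 + r * η * (1 - t ^ 2)) + a / ρ * (1 + n * t) := by
      field_simp
      ring
    rw [hlhs, hrel]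
    field_simp
    ring
  refine ⟨?_, ?_⟩
  · exact (integrableOn_congr_fun heq isClosed_sphere.measurableSet).1 (hint.sub hzint)
  · rw [← setIntegral_congr_fun isClosed_sphere.measurableSet heq, integral_sub hint hzint, hz,
      sub_zero]
    refine hD.congr_of_eventuallyEq (Eventually.of_forall fun s => ?_)
    refine setIntegral_congr_fun isClosed_sphere.measurableSet fun y hy => ?_
    simp only [hQ, sqrt_chordSq_inner he (mem_sphere_zero_iff_norm.1 hy)]

end RadialField

section Profile

variable {f f' : ℝ → ℝ} {n : ℕ} {ε : ℝ}

lemma antitoneOn_pow_mul (hn : 1 ≤ n) (hf : ∀ x, 0 < x → HasDerivAt f (f' x) x)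
    (hneg : ∀ x ∈ Ioo 0 ε, f' x + n * f x / x < 0) :
    AntitoneOn (fun x => x ^ n * f x) (Ioo 0 ε) := by
  have hd : ∀ x, 0 < x → HasDerivAt (fun x => x ^ n * f x) (x ^ n * (f' x + n * f x / x)) x := by
    intro x hx
    refine ((hasDerivAt_pow n x).mul (hf x hx)).congr_deriv ?_
    obtain ⟨m, rfl⟩ := Nat.exists_eq_add_of_le' hn
    simp only [Nat.add_sub_cancel, pow_succ]
    field_simp
    ring
  refine antitoneOn_of_deriv_nonpos (convex_Ioo 0 ε)
    (fun x hx => (hd x hx.1).continuousAt.continuousWithinAt) ?_ ?_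
  · exact fun x hx => (hd x (interior_subset hx).1).differentiableAt.differentiableWithinAt
  · intro x hx
    have hx' := interior_subset hx
    rw [(hd x hx'.1).deriv]
    exact mul_nonpos_of_nonneg_of_nonpos (pow_nonneg hx'.1.le n) (hneg x hx').le

lemma nonpos_of_integrableOn (hn : 1 ≤ n) (hf : ∀ x, 0 < x → HasDerivAt f (f' x) x)
    (hneg : ∀ x ∈ Ioo 0 ε, f' x + n * f x / x < 0)
    (hint : IntegrableOn (fun r => |f r| * r ^ (n - 1)) (Ioo 0 1)) :
    ∀ x ∈ Ioo 0 ε, f x ≤ 0 := by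
  intro a ha
  by_contra! hfa
  have hanti := antitoneOn_pow_mul hn hf hneg
  set c := a ^ n * f a with hc
  have hc0 : 0 < c := mul_pos (pow_pos ha.1 n) hfa
  set b := min a 1 with hb
  have hb0 : 0 < b := lt_min ha.1 one_pos
  have hle : ∀ x ∈ Ioo 0 b, ‖x⁻¹‖ ≤ c⁻¹ * (|f x| * x ^ (n - 1)) := by
    intro x hx
    have hxa : x < a := hx.2.trans_le (min_le_left _ _)
    have h1 : c ≤ x ^ n * f x := hanti ⟨hx.1, hxa.trans ha.2⟩ ha hxa.le
    rw [Real.norm_of_nonneg (inv_nonneg.2 hx.1.le), inv_mul_eq_div, le_div_iff₀ hc0,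
      inv_mul_eq_div, div_le_iff₀ hx.1]
    calc c ≤ x ^ n * f x := h1
      _ ≤ x ^ n * |f x| := by
        have := le_abs_self (f x)
        have := hx.1.le
        gcongr
      _ = _ := by rw [mul_assoc, ← pow_succ, Nat.sub_add_cancel hn]; ring
  have hinv : IntegrableOn (fun x : ℝ => x⁻¹) (Ioo 0 b) := by
    refine Integrable.mono' ((hint.mono_set (Ioo_subset_Ioo_right (min_le_right _ _))).const_mul
      c⁻¹) measurable_inv.aestronglyMeasurable ?_
    exact ae_restrict_of_forall_mem measurableSet_Ioo hle
  rw [← intervalIntegrable_iff_integrableOn_Ioo_of_le hb0.le, intervalIntegrable_inv_iff] at hinv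
  rcases hinv with h | h
  · exact hb0.ne h
  · exact h left_mem_uIcc

/-- A mean value bound for `f` on dyadic intervals. -/
lemma ofReal_abs_le_lintegral_dyadic (hn : 1 ≤ n) (hf : ∀ x, 0 < x → HasDerivAt f (f' x) x)
    (hneg : ∀ x ∈ Ioo 0 ε, f' x + n * f x / x < 0)
    (hint : IntegrableOn (fun r => |f r| * r ^ (n - 1)) (Ioo 0 1)) {x : ℝ} (hx : 0 < x)
    (hxε : 2 * x ≤ ε) :
    ENNReal.ofReal |f x| ≤
      2 ^ (n + 1) * ∫⁻ s in Ioo x (2 * x), ENNReal.ofReal (|f s| / s) := by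
  have hanti := antitoneOn_pow_mul hn hf hneg
  have hnonpos := nonpos_of_integrableOn hn hf hneg hint
  set c := |f x| / (2 ^ (n + 1) * x) with hc
  have hle : ∀ s ∈ Ioo x (2 * x), c ≤ |f s| / s := by
    intro s hs
    have hs0 : 0 < s := hx.trans hs.1
    have hxm : x ∈ Ioo 0 ε := ⟨hx, by linarith⟩
    have hsm : s ∈ Ioo 0 ε := ⟨hs0, by linarith [hs.2]⟩
    have h1 : s ^ n * f s ≤ x ^ n * f x := hanti hxm hsm hs.1.le
    rw [hc, abs_of_nonpos (hnonpos x hxm), abs_of_nonpos (hnonpos s hsm),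
      div_le_div_iff₀ (by positivity) hs0]
    have h2 : -f x * x ^ n ≤ -f s * (2 * x) ^ n := by
      have h3 : -f s * s ^ n ≤ -f s * (2 * x) ^ n := by
        have := hs.2.le
        have := neg_nonneg.2 (hnonpos s hsm)
        gcongr
      linarith
    have h4 : -f x ≤ -f s * 2 ^ n := by
      rw [mul_pow] at h2
      refine le_of_mul_le_mul_right ?_ (pow_pos hx n)
      linarith
    have h5 := neg_nonneg.2 (hnonpos x hxm)
    calc -f x * s ≤ -f x * (2 * x) := by gcongr; exact hs.2.le
      _ ≤ -f s * 2 ^ n * (2 * x) := by gcongr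
      _ = _ := by ring
  calc ENNReal.ofReal |f x| = 2 ^ (n + 1) * (ENNReal.ofReal c * volume (Ioo x (2 * x))) := by
        rw [Real.volume_Ioo, ← ENNReal.ofReal_mul (by positivity),
          show (2 : ENNReal) ^ (n + 1) = ENNReal.ofReal (2 ^ (n + 1)) by
            rw [ENNReal.ofReal_pow (by norm_num)]; simp,
          ← ENNReal.ofReal_mul (by positivity), hc]
        congr 1
        field_simp
        ring
    _ = 2 ^ (n + 1) * ∫⁻ _ in Ioo x (2 * x), ENNReal.ofReal c := by rw [setLIntegral_const]
    _ ≤ _ := by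
      gcongr 2 ^ (n + 1) * ?_
      exact setLIntegral_mono' measurableSet_Ioo fun s hs => ENNReal.ofReal_le_ofReal (hle s hs)

end Profile

section SphereBounds

variable {f f' : ℝ → ℝ} {n : ℕ} {ε R : ℝ}
  {E : Type*} [NormedAddCommGroup E] [InnerProductSpace ℝ E] [MeasurableSpace E]
  [BorelSpace E] [FiniteDimensional ℝ E] {e : E}

lemma exists_lintegral_sphere_abs_le (hn : 1 ≤ n) (hE : Module.finrank ℝ E = n + 1)
    (he : ‖e‖ = 1) (hfm : Measurable f) (hf : ∀ x, 0 < x → HasDerivAt f (f' x) x) (hε : 0 < ε)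
    (hε1 : ε ≤ 1) (hneg : ∀ x ∈ Ioo 0 ε, f' x + n * f x / x < 0)
    (hint : IntegrableOn (fun r => |f r| * r ^ (n - 1)) (Ioo 0 1)) (hR : 0 < R) :
    ∃ K : ENNReal, K ≠ ⊤ ∧ ∀ ρ : E → ℝ,
      (∀ y ∈ sphere 0 1, 0 < ρ y ∧ R / 2 * ‖y - e‖ ≤ ρ y ∧ ρ y ≤ 4 * R) →
      ∫⁻ y in sphere 0 1, ENNReal.ofReal |f (ρ y)| ∂μH[(n : ℝ)] ≤ K := by
  have hfin := hausdorffMeasure_sphere_lt_top hn hE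
  obtain ⟨C, hC, hcap⟩ := exists_hausdorffMeasure_cap_le hn hE he
  have hfc : ContinuousOn f (Icc (ε / 2) (4 * R)) := fun x hx =>
    (hf x (by linarith [hx.1])).continuousAt.continuousWithinAt
  obtain ⟨M, hM⟩ := isCompact_Icc.exists_bound_of_continuousOn hfc
  set g : ℝ → ENNReal := fun s => ENNReal.ofReal (|f s| / s) with hg
  have hgm : Measurable g := by fun_prop
  set H : E → ℝ → ENNReal := fun y => (Ioi (R / 2 * ‖y - e‖)).indicator g with hH
  have hHm : Measurable (Function.uncurry H) := by
    have : Function.uncurry H =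
        {q : E × ℝ | R / 2 * ‖q.1 - e‖ < q.2}.indicator fun q => g q.2 := by
      ext q
      simp [hH, Function.uncurry_def, indicator_apply]
    rw [this]
    exact (hgm.comp measurable_snd).indicator (measurableSet_lt (by fun_prop) measurable_snd)
  have : IsFiniteMeasure ((μH[(n : ℝ)] : Measure E).restrict (sphere 0 1)) :=
    ⟨by simpa using hfin⟩
  have hswap : ∫⁻ y in sphere (0 : E) 1, (∫⁻ s in Ioo 0 ε, H y s) ∂μH[(n : ℝ)] ≤
      C * ENNReal.ofReal ((2 / R) ^ n) *
        ∫⁻ s in Ioo (0 : ℝ) 1, ENNReal.ofReal (|f s| * s ^ (n - 1)) := by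
    rw [lintegral_lintegral_swap hHm.aemeasurable,
      ← lintegral_const_mul' _ _ (ENNReal.mul_ne_top hC (by simp))]
    refine (setLIntegral_mono' measurableSet_Ioo fun s hs => ?_).trans
      (lintegral_mono_set (Ioo_subset_Ioo_right hε1))
    have hs0 := hs.1
    have hind : ∀ y, H y s = (ball e (2 / R * s)).indicator (fun _ => g s) y := by
      intro y
      have : R / 2 * ‖y - e‖ < s ↔ ‖y - e‖ < 2 / R * s := by
        rw [div_mul_eq_mul_div, div_mul_eq_mul_div, div_lt_iff₀ two_pos, lt_div_iff₀ hR,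
          mul_comm R, mul_comm s]
      simp only [hH, indicator, mem_Ioi, mem_ball_iff_norm, this]
    simp_rw [hind]
    rw [lintegral_indicator measurableSet_ball, setLIntegral_const,
      Measure.restrict_apply measurableSet_ball, inter_comm]
    calc _ ≤ g s * (C * ENNReal.ofReal ((2 / R * s) ^ n)) := by
          gcongr
          exact hcap _ (by positivity)
      _ = C * ENNReal.ofReal ((2 / R) ^ n) * ENNReal.ofReal (|f s| * s ^ (n - 1)) := by
        rw [hg, mul_left_comm, mul_assoc, ← ENNReal.ofReal_mul (by positivity),
          ← ENNReal.ofReal_mul (by positivity)]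
        congr 2
        obtain ⟨m, rfl⟩ := Nat.exists_eq_add_of_le' hn
        rw [Nat.add_sub_cancel, mul_pow, pow_succ s]
        field_simp
  have hfinite : ∫⁻ s in Ioo (0 : ℝ) 1, ENNReal.ofReal (|f s| * s ^ (n - 1)) ≠ ⊤ :=
    hint.lintegral_lt_top.ne
  refine ⟨ENNReal.ofReal M * μH[(n : ℝ)] (sphere (0 : E) 1) + 2 ^ (n + 1) *
    (C * ENNReal.ofReal ((2 / R) ^ n) *
        ∫⁻ s in Ioo (0 : ℝ) 1, ENNReal.ofReal (|f s| * s ^ (n - 1))), ?_, fun ρ hρ => ?_⟩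
  · have h1 := ENNReal.mul_ne_top (ENNReal.ofReal_ne_top (r := M)) hfin.ne
    have h2 := ENNReal.mul_ne_top (ENNReal.mul_ne_top hC
      (ENNReal.ofReal_ne_top (r := (2 / R) ^ n))) hfinite
    exact ENNReal.add_ne_top.2 ⟨h1, ENNReal.mul_ne_top (by simp) h2⟩
  calc _ ≤ ∫⁻ y in sphere (0 : E) 1, (ENNReal.ofReal M + 2 ^ (n + 1) * ∫⁻ s in Ioo 0 ε, H y s)
          ∂μH[(n : ℝ)] := by
        refine setLIntegral_mono' isClosed_sphere.measurableSet fun y hy => ?_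
        obtain ⟨h0, h1, h2⟩ := hρ y hy
        rcases le_total (ε / 2) (ρ y) with h | h
        · exact (ENNReal.ofReal_le_ofReal (hM _ ⟨h, h2⟩)).trans le_self_add
        · refine (ofReal_abs_le_lintegral_dyadic hn hf hneg hint h0 (by linarith)).trans
            (le_add_left ?_)
          gcongr 2 ^ (n + 1) * ?_
          calc _ = ∫⁻ s in Ioo (ρ y) (2 * ρ y), H y s :=
                setLIntegral_congr_fun measurableSet_Ioo fun s hs =>
                  (indicator_of_mem (mem_Ioi.2 (h1.trans_lt hs.1)) g).symm
            _ ≤ _ := lintegral_mono_set (Ioo_subset_Ioo h0.le (by linarith))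
    _ = ENNReal.ofReal M * μH[(n : ℝ)] (sphere (0 : E) 1) +
        2 ^ (n + 1) * ∫⁻ y in sphere (0 : E) 1, (∫⁻ s in Ioo 0 ε, H y s) ∂μH[(n : ℝ)] := by
      rw [lintegral_add_left measurable_const, setLIntegral_const,
        lintegral_const_mul' _ _ (by simp)]
    _ ≤ _ := by gcongr

/-- If a radial profile, bounded below, is not integrable on hypersurfaces, then its surface
integral as a function of the chordal distance diverges. -/
lemma lintegral_sphere_eq_top {h : ℝ → ℝ} {c : ℝ} (hn : 1 ≤ n) (hE : Module.finrank ℝ E = n + 1)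
    (he : ‖e‖ = 1) (hm : Measurable h) (hc : ContinuousOn h (Ioi 0)) (hR : 0 < R)
    (hpos : ∀ x ∈ Ioc 0 (4 * R), 0 ≤ c - h x)
    (hnot : ¬ IntegrableOn (fun r => |h r| * r ^ (n - 1)) (Ioo 0 1)) :
    ∫⁻ y in sphere (0 : E) 1, ENNReal.ofReal (c - h (R * ‖y - e‖)) ∂μH[(n : ℝ)] = ⊤ := by
  by_contra htop
  obtain ⟨κ, C, hκ, hC, hle⟩ := exists_lintegral_norm_le_lintegral_sphere (n := n) he
  have hF : Module.finrank ℝ (ℝ ∙ e)ᗮ = n :=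
    haveI : Fact (Module.finrank ℝ E = n + 1) := ⟨hE⟩
    Submodule.finrank_orthogonal_span_singleton (by rintro rfl; simp at he)
  have : Nontrivial (ℝ ∙ e)ᗮ := Module.nontrivial_of_finrank_pos (R := ℝ) (by omega)
  have hH : (μH[(n : ℝ)] : Measure (ℝ ∙ e)ᗮ).IsAddHaarMeasure := by
    have := isAddHaarMeasure_hausdorffMeasure (E := (ℝ ∙ e)ᗮ)
    rwa [hF] at this
  set b := min κ 4 with hb
  have hb0 : 0 < b := lt_min hκ (by norm_num)
  have hlt := (hle (fun s => ENNReal.ofReal (c - h (R * s))) (by fun_prop)).trans_lt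
    (ENNReal.mul_lt_top hC.lt_top (lt_top_iff_ne_top.2 htop))
  have hball : IntegrableOn (fun w : (ℝ ∙ e)ᗮ => c - h (R * ‖w‖)) (ball 0 b) μH[(n : ℝ)] := by
    have hm' : Measurable fun w : (ℝ ∙ e)ᗮ => c - h (R * ‖w‖) := by fun_prop
    refine ⟨hm'.aestronglyMeasurable, ?_⟩
    rw [hasFiniteIntegral_iff_ofReal]
    · exact (lintegral_mono_set (ball_subset_ball (min_le_left _ _))).trans_lt hlt
    · have hz : ∀ᵐ w : (ℝ ∙ e)ᗮ ∂μH[(n : ℝ)], w ≠ 0 := Measure.ae_ne _ 0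
      filter_upwards [ae_restrict_mem measurableSet_ball, ae_restrict_of_ae hz] with w hw hw0
      rw [mem_ball_zero_iff] at hw
      have h4 : ‖w‖ ≤ 4 := hw.le.trans (min_le_right _ _)
      have := norm_pos_iff.2 hw0
      exact hpos _ ⟨by positivity, by nlinarith⟩
  rw [integrableOn_fun_norm_addHaar _ (f := fun s => c - h (R * s)), hF] at hball
  have hpow : IntegrableOn (fun y : ℝ => y ^ (n - 1) * c) (Ioo 0 b) :=
    (Continuous.integrableOn_Icc (by fun_prop)).mono_set Ioo_subset_Icc_self
  have hsc : IntegrableOn (fun y : ℝ => (R * y) ^ (n - 1) * h (R * y)) (Ioo 0 b) := by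
    refine IntegrableOn.congr_fun ((hpow.sub hball).const_mul (R ^ (n - 1))) ?_ measurableSet_Ioo
    intro y _
    simp only [Pi.sub_apply, smul_eq_mul]
    ring
  have hsc2 : IntegrableOn (fun x : ℝ => x ^ (n - 1) * h x) (Ioo 0 (R * b)) := by
    rw [← intervalIntegrable_iff_integrableOn_Ioo_of_le (by positivity),
      ← IntervalIntegrable.comp_mul_left_iff hR.ne', zero_div, mul_div_cancel_left₀ _ hR.ne',
      intervalIntegrable_iff_integrableOn_Ioo_of_le hb0.le]
    exact hsc
  have hfar : IntegrableOn (fun x : ℝ => x ^ (n - 1) * h x) (Icc (R * b) 1) := by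
    refine ContinuousOn.integrableOn_Icc ((by fun_prop : Continuous _).continuousOn.mul
      (hc.mono fun x hx => ?_))
    exact (mul_pos hR hb0).trans_le hx.1
  refine hnot ?_
  have hall : IntegrableOn (fun x : ℝ => x ^ (n - 1) * h x) (Ioo 0 1) := by
    refine (hsc2.union hfar).mono_set fun x hx => ?_
    rcases lt_or_ge x (R * b) with h' | h'
    · exact Or.inl ⟨hx.1, h'⟩
    · exact Or.inr ⟨h', hx.2.le⟩
  refine IntegrableOn.congr_fun hall.norm (fun x hx => ?_) measurableSet_Ioo
  simp only [norm_mul, norm_pow, Real.norm_eq_abs, abs_of_pos hx.1]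
  ring

lemma hausdorffMeasure_sphere_pos (hE : Module.finrank ℝ E = n + 1)
    (he : ‖e‖ = 1) : 0 < μH[(n : ℝ)] (sphere (0 : E) 1) := by
  obtain ⟨κ, C, hκ, hC, hle⟩ := exists_lintegral_norm_le_lintegral_sphere (n := n) he
  have hF : Module.finrank ℝ (ℝ ∙ e)ᗮ = n :=
    haveI : Fact (Module.finrank ℝ E = n + 1) := ⟨hE⟩
    Submodule.finrank_orthogonal_span_singleton (by rintro rfl; simp at he)
  have hH : (μH[(n : ℝ)] : Measure (ℝ ∙ e)ᗮ).IsAddHaarMeasure := by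
    have := isAddHaarMeasure_hausdorffMeasure (E := (ℝ ∙ e)ᗮ)
    rwa [hF] at this
  have h := hle (fun _ => 1) measurable_const
  simp only [lintegral_const, one_mul, Measure.restrict_apply_univ] at h
  rw [pos_iff_ne_zero]
  intro h0
  rw [h0, mul_zero] at h
  exact (measure_ball_pos _ _ hκ).not_ge h

end SphereBounds

section Blowup

variable {E : Type*} [NormedAddCommGroup E] [InnerProductSpace ℝ E]

lemma hasGradientAt_comp_norm [CompleteSpace E] {k : ℝ → ℝ} {a : ℝ} {z : E} (hz : z ≠ 0)
    (hk : HasDerivAt k a ‖z‖) : HasGradientAt (fun x => k ‖x‖) ((a / ‖z‖) • z) z := by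
  have hn := norm_pos_iff.2 hz
  have hs : √(‖z‖ ^ 2) = ‖z‖ := Real.sqrt_sq hn.le
  have hks : HasDerivAt (fun x => k √x) (a * (1 / (2 * ‖z‖))) (‖z‖ ^ 2) := by
    have h := Real.hasDerivAt_sqrt (pow_pos hn 2).ne'
    rw [hs] at h
    exact HasDerivAt.comp _ (by rwa [hs]) h
  have h := hks.comp_hasFDerivAt z (hasStrictFDerivAt_norm_sq z).hasFDerivAt
  rw [hasGradientAt_iff_hasFDerivAt]
  have hfun : (fun x => k √x) ∘ (fun x : E => ‖x‖ ^ 2) = fun x => k ‖x‖ := by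
    funext x
    rw [Function.comp_apply, Real.sqrt_sq (norm_nonneg x)]
  rw [hfun] at h
  refine h.congr_fderiv ?_
  ext x
  simp only [map_smul, smul_apply, InnerProductSpace.toDual_apply_apply,
    innerSL_apply_apply, smul_eq_mul, nsmul_eq_mul, Nat.cast_ofNat]
  field_simp

variable {e : E} {f f' : ℝ → ℝ} {n : ℕ} {ε R : ℝ}

lemma continuousOn_comp_norm_smul_sub (he : ‖e‖ = 1) {g : ℝ → ℝ} (hg : ContinuousOn g (Ioi 0))
    {r η : ℝ} (hr : 0 < r) (hη : 0 < η) (h : r ≠ η) :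
    ContinuousOn (fun y => g ‖r • e - η • y‖) (sphere 0 1) := by
  refine hg.comp (by fun_prop) fun y hy => ?_
  have hy1 := mem_sphere_zero_iff_norm.1 hy
  rw [mem_Ioi, ← sqrt_chordSq_inner he hy1]
  exact Real.sqrt_pos.2 (chordSq_pos hr hη h (inner_mem_Icc_of_unit he hy1).2)

lemma norm_smul_sub_smul_mem {y : E} (he : ‖e‖ = 1) (hy : ‖y‖ = 1) {r η : ℝ} (hR : 0 < R)
    (hr : |r - R| < R / 4) (hη : |η - R| < R / 4) (h : r ≠ η) :
    0 < ‖r • e - η • y‖ ∧ R / 2 * ‖y - e‖ ≤ ‖r • e - η • y‖ ∧ ‖r • e - η • y‖ ≤ 4 * R := by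
  rw [abs_lt] at hr hη
  have hr0 : 0 < r := by linarith
  have hη0 : 0 < η := by linarith
  have ht := inner_mem_Icc_of_unit he hy
  have h1t := sub_nonneg.2 ht.2
  have hsq := norm_smul_sub_smul_sq he hy r η
  have hye := norm_sub_sq_of_unit he hy
  have hrη : R ^ 2 / 2 ≤ r * η := by nlinarith
  refine ⟨?_, ?_, ?_⟩
  · rw [← sqrt_chordSq_inner he hy]
    exact Real.sqrt_pos.2 (chordSq_pos hr0 hη0 h ht.2)
  · refine le_of_sq_le_sq ?_ (norm_nonneg _)
    rw [hsq, mul_pow, hye, ← sq_sub_add_eq_chordSq]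
    nlinarith [sq_nonneg (r - η)]
  · refine (norm_sub_le _ _).trans ?_
    rw [norm_smul, norm_smul, he, hy, Real.norm_of_nonneg hr0.le, Real.norm_of_nonneg hη0.le]
    linarith

variable [MeasurableSpace E] [BorelSpace E]

/-- Fatou's lemma for the potentials `‖r • e - η • y‖` as `(r, η)` approaches the diagonal. -/
lemma tendsto_lintegral_sphere_nhds_top {h : ℝ → ℝ} {c : ℝ} (hn : 1 ≤ n) (hR : 0 < R)
    (hm : Measurable h) (hc : ContinuousOn h (Ioi 0)) {l : Filter (ℝ × ℝ)}
    [l.IsCountablyGenerated] (hl : l ≤ 𝓝 (R, R))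
    (htop : ∫⁻ y in sphere (0 : E) 1, ENNReal.ofReal (c - h (R * ‖y - e‖)) ∂μH[(n : ℝ)] = ⊤) :
    Tendsto (fun p : ℝ × ℝ => ∫⁻ y in sphere (0 : E) 1,
      ENNReal.ofReal (c - h ‖p.1 • e - p.2 • y‖) ∂μH[(n : ℝ)]) l (𝓝 ⊤) := by
  rcases l.eq_or_neBot with rfl | hne
  · exact tendsto_bot
  refine tendsto_of_le_liminf_of_limsup_le ?_ le_top
  refine le_trans ?_ (lintegral_liminf_le' fun p => ?_)
  · rw [← htop]
    refine lintegral_mono_ae ?_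
    have : NullSingletonClass (μH[(n : ℝ)] : Measure E) :=
      Measure.nullSingletonClass_hausdorff _ (by positivity)
    filter_upwards [ae_restrict_of_ae (Measure.ae_ne (μH[(n : ℝ)] : Measure E) e)] with y hy
    have hpos : 0 < R * ‖y - e‖ := mul_pos hR (norm_pos_iff.2 (sub_ne_zero.2 hy))
    have hρ : Tendsto (fun p : ℝ × ℝ => ‖p.1 • e - p.2 • y‖) l (𝓝 (R * ‖y - e‖)) := by
      have hcont : Continuous fun p : ℝ × ℝ => ‖p.1 • e - p.2 • y‖ := by fun_prop
      have := (hcont.tendsto (R, R)).mono_left hl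
      rwa [← smul_sub, norm_smul, Real.norm_of_nonneg hR.le, norm_sub_rev] at this
    have hlim := (ENNReal.continuous_ofReal.tendsto _).comp
      (((hc.continuousAt (Ioi_mem_nhds hpos)).tendsto.comp hρ).const_sub c)
    exact hlim.liminf_eq.ge
  · exact Measurable.aemeasurable (by fun_prop)

variable [FiniteDimensional ℝ E]

lemma tendsto_neg_setIntegral_radialIntegrand (hn : 1 ≤ n) (hE : Module.finrank ℝ E = n + 1)
    (he : ‖e‖ = 1) (hfm : Measurable f) (hfm' : Measurable f')
    (hf : ∀ x, 0 < x → HasDerivAt f (f' x) x) (hf' : ContinuousOn f' (Ioi 0)) (hε : 0 < ε)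
    (hneg : ∀ x ∈ Ioo 0 ε, f' x + n * f x / x < 0)
    (hint : IntegrableOn (fun r => |f r| * r ^ (n - 1)) (Ioo 0 1))
    (hnot : ¬ IntegrableOn (fun r => |f' r + n * f r / r| * r ^ (n - 1)) (Ioo 0 1)) (hR : 0 < R) :
    Tendsto (fun p : ℝ × ℝ =>
        -∫ y in sphere (0 : E) 1, radialIntegrand n f f' p.1 p.2 ⟪e, y⟫ ∂μH[(n : ℝ)])
      (𝓝[{p : ℝ × ℝ | p.1 ≠ p.2}] (R, R)) atTop := by
  wlog hε1 : ε ≤ 1 generalizing ε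
  · exact this (ε := min ε 1) (by positivity)
      (fun x hx => hneg x ⟨hx.1, hx.2.trans_le (min_le_left _ _)⟩) (min_le_right _ _)
  have hfin := hausdorffMeasure_sphere_lt_top hn hE
  have hfc : ContinuousOn f (Ioi 0) := fun x hx => (hf x hx).continuousAt.continuousWithinAt
  set L : ℝ → ℝ := fun x => f' x + n * f x / x with hL
  have hLm : Measurable L := by fun_prop
  have hLc : ContinuousOn L (Ioi 0) :=
    hf'.add ((continuousOn_const.mul hfc).div continuousOn_id fun x hx => ne_of_gt hx)
  obtain ⟨C, hC0, hC⟩ : ∃ C, 0 ≤ C ∧ ∀ x ∈ Ioc 0 (4 * R), L x ≤ C := by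
    obtain ⟨M, hM⟩ := isCompact_Icc.exists_bound_of_continuousOn
      (hLc.mono fun x (hx : x ∈ Icc (ε / 2) (4 * R)) => (half_pos hε).trans_le hx.1)
    refine ⟨max M 0, le_max_right _ _, fun x hx => ?_⟩
    rcases lt_or_ge x ε with h | h
    · exact (hneg x ⟨hx.1, h⟩).le.trans (le_max_right _ _)
    · exact ((le_abs_self _).trans (hM x ⟨by linarith, hx.2⟩)).trans (le_max_left _ _)
  obtain ⟨K, hK, hfK⟩ := exists_lintegral_sphere_abs_le hn hE he hfm hf hε hε1 hneg hint hR
  have htop := lintegral_sphere_eq_top hn hE he hLm hLc hR (fun x hx => sub_nonneg.2 (hC x hx)) hnot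
  have hdiv := tendsto_lintegral_sphere_nhds_top hn hR hLm hLc
    (l := 𝓝[{p : ℝ × ℝ | p.1 ≠ p.2}] (R, R)) nhdsWithin_le_nhds htop
  set σ := (μH[(n : ℝ)] : Measure E).real (sphere 0 1) with hσ
  refine tendsto_atTop.2 fun M => ?_
  set B := 3 * (M + 2 * C * σ + (7 * n + 2) / R * K.toReal) with hB
  have hev : ∀ᶠ p : ℝ × ℝ in 𝓝 (R, R), |p.1 - R| < R / 4 ∧ |p.2 - R| < R / 4 := by
    have h1 : Tendsto (fun p : ℝ × ℝ => p.1) (𝓝 (R, R)) (𝓝 R) := continuous_fst.tendsto _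
    have h2 : Tendsto (fun p : ℝ × ℝ => p.2) (𝓝 (R, R)) (𝓝 R) := continuous_snd.tendsto _
    exact (h1.eventually (ball_mem_nhds R (by positivity))).and
      (h2.eventually (ball_mem_nhds R (by positivity)))
  filter_upwards [hdiv.eventually (lt_mem_nhds (ENNReal.ofReal_lt_top (r := B))),
    self_mem_nhdsWithin, nhdsWithin_le_nhds hev] with p hp hne ⟨h1, h2⟩
  have hr0 : 0 < p.1 := by linarith [(abs_lt.1 h1).1]
  have hη0 : 0 < p.2 := by linarith [(abs_lt.1 h2).1]
  have hmem : ∀ y ∈ sphere (0 : E) 1, _ := fun y hy =>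
    norm_smul_sub_smul_mem he (mem_sphere_zero_iff_norm.1 hy) hR h1 h2 hne
  have hmeas : MeasurableSet (sphere (0 : E) 1) := isClosed_sphere.measurableSet
  have hiL : IntegrableOn (fun y => C - L ‖p.1 • e - p.2 • y‖) (sphere (0 : E) 1) μH[(n : ℝ)] :=
    integrableOn_of_isCompact_of_measure_lt_top (isCompact_sphere 0 1) hfin
      (continuousOn_const.sub (continuousOn_comp_norm_smul_sub he hLc hr0 hη0 hne))
  have hif : IntegrableOn (fun y => |f ‖p.1 • e - p.2 • y‖|) (sphere (0 : E) 1) μH[(n : ℝ)] :=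
    integrableOn_of_isCompact_of_measure_lt_top (isCompact_sphere 0 1) hfin
      (continuousOn_comp_norm_smul_sub he hfc hr0 hη0 hne).abs
  have hiC : IntegrableOn (fun _ => 2 * C) (sphere (0 : E) 1) μH[(n : ℝ)] :=
    integrableOn_const hfin.ne
  have hBlt : B < ∫ y in sphere (0 : E) 1, (C - L ‖p.1 • e - p.2 • y‖) ∂μH[(n : ℝ)] := by
    rw [← ofReal_integral_eq_lintegral_ofReal hiL (ae_restrict_of_forall_mem hmeas fun y hy =>
      sub_nonneg.2 (hC _ ⟨(hmem y hy).1, (hmem y hy).2.2⟩))] at hp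
    exact (ENNReal.ofReal_lt_ofReal_iff'.1 hp).1
  have hfle : ∫ y in sphere (0 : E) 1, |f ‖p.1 • e - p.2 • y‖| ∂μH[(n : ℝ)] ≤ K.toReal := by
    rw [← ENNReal.ofReal_le_iff_le_toReal hK,
      ofReal_integral_eq_lintegral_ofReal hif (ae_of_all _ fun y => abs_nonneg _)]
    exact hfK _ hmem
  have hlow := setIntegral_mono_on (((hiL.const_mul (1 / 3)).sub hiC).sub
    (hif.const_mul ((7 * n + 2) / R)))
    (hasDerivAt_setIntegral_sphere_radial hE he hfin hf hf' hr0 hη0 hne).1.neg hmeas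
    fun y hy => by
      have hy1 := mem_sphere_zero_iff_norm.1 hy
      have := le_neg_radialIntegrand n hR hC0 hC h1 h2 hne (inner_mem_Icc_of_unit he hy1)
      rw [sqrt_chordSq_inner he hy1] at this
      exact this
  rw [integral_sub' ((hiL.const_mul _).sub hiC) (hif.const_mul _),
    integral_sub' (hiL.const_mul _) hiC, setIntegral_const, integral_const_mul,
    integral_const_mul, integral_neg', smul_eq_mul, ← hσ] at hlow
  have hcoef : (7 * n + 2) / R * ∫ y in sphere (0 : E) 1, |f ‖p.1 • e - p.2 • y‖| ∂μH[(n : ℝ)] ≤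
      (7 * n + 2) / R * K.toReal := by gcongr
  linarith

end Blowup

lemma norm_e1 (N : ℕ) (hN : 0 < N) : ‖e1 N hN‖ = 1 := by
  simp [e1]

lemma contDiffOn_profile_of_radial {E : Type*} [NormedAddCommGroup E] [InnerProductSpace ℝ E]
    {W : E → ℝ} {k : ℝ → ℝ} {e : E} {m : ℕ∞} (he : ‖e‖ = 1) (hrad : ∀ x, W x = k ‖x‖)
    (hW : ContDiffOn ℝ m W {(0 : E)}ᶜ) : ContDiffOn ℝ m k (Ioi 0) := by
  have he0 : e ≠ 0 := norm_ne_zero_iff.1 (by rw [he]; exact one_ne_zero)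
  have h := hW.comp (s := Ioi 0) (f := fun s : ℝ => s • e)
    (contDiff_id.smul contDiff_const).contDiffOn fun s hs => smul_ne_zero (ne_of_gt hs) he0
  refine h.congr fun s hs => ?_
  rw [Function.comp_apply, hrad, norm_smul, he, mul_one, Real.norm_of_nonneg (le_of_lt hs)]

lemma omegaFun_eq_of_radial {N : ℕ} (hN : 0 < N) {W : Euc N → ℝ} {k : ℝ → ℝ}
    (hrad : ∀ x, W x = k ‖x‖) (hk : ∀ x, 0 < x → DifferentiableAt ℝ k x) {r η : ℝ} (hr : 0 < r)
    (hη : 0 < η) (h : r ≠ η) :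
    omegaFun N hN W r η = -(sphereArea N)⁻¹ * ∫ y in sphere (0 : Euc N) 1,
      deriv k ‖r • e1 N hN - η • y‖ / ‖r • e1 N hN - η • y‖ * (r - η * ⟪e1 N hN, y⟫)
        ∂(μH[(N : ℝ) - 1]) := by
  have he := norm_e1 N hN
  rw [omegaFun]
  congr 1
  refine setIntegral_congr_fun isClosed_sphere.measurableSet fun y hy => ?_
  have hy1 := mem_sphere_zero_iff_norm.1 hy
  have hz : 0 < ‖r • e1 N hN - η • y‖ := by
    rw [← sqrt_chordSq_inner he hy1]
    exact Real.sqrt_pos.2 (chordSq_pos hr hη h (inner_mem_Icc_of_unit he hy1).2)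
  have hW : W = fun x => k ‖x‖ := funext hrad
  beta_reduce
  rw [hW, (hasGradientAt_comp_norm (norm_pos_iff.1 hz) (hk _ hz).hasDerivAt).gradient,
    real_inner_smul_left, inner_sub_left, real_inner_smul_left, real_inner_smul_left,
    real_inner_self_eq_norm_sq, he, real_inner_comm, one_pow, mul_one]

/-- Lemma 2.3(iii): if ΔW is negative near the origin, k' is locally integrable on
hypersurfaces, but ΔW = k'' + (N−1)k'/r is not, then ∂₁ω(r,η) → +∞ as (r,η) → (R,R)
off the diagonal, for every R > 0. -/
theorem partial_omega_tendsto_atTop (N : ℕ) (hN : 2 ≤ N) (W : Euc N → ℝ) (k : ℝ → ℝ)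
    (hrad : ∀ x, W x = k ‖x‖)
    (hW : ContDiffOn ℝ 3 W {(0 : Euc N)}ᶜ)
    (hk' : LocIntOnHyp N (deriv k))
    (hneg : ∃ ε > 0, ∀ r ∈ Ioo (0:ℝ) ε,
      deriv (deriv k) r + (N - 1) * deriv k r / r < 0)
    (hnotint : ¬ LocIntOnHyp N (fun r => deriv (deriv k) r + (N - 1) * deriv k r / r))
    (R : ℝ) (hR : 0 < R) :
    Tendsto (fun p : ℝ × ℝ => deriv (fun s => omegaFun N (by omega) W s p.2) p.1)
      (𝓝[{p : ℝ × ℝ | p.1 ≠ p.2}] (R, R)) atTop := by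
  have hN0 : 0 < N := by omega
  obtain ⟨ε, hε, hneg⟩ := hneg
  obtain ⟨n, rfl⟩ := Nat.exists_eq_add_of_le' hN0
  have hn : 1 ≤ n := by omega
  have hcast : ((n + 1 : ℕ) : ℝ) - 1 = n := by push_cast; ring
  have hexp : n + 1 - 2 = n - 1 := by omega
  have hE : Module.finrank ℝ (Euc (n + 1)) = n + 1 := finrank_euclideanSpace_fin
  have he := norm_e1 (n + 1) hN0
  have hfin := hausdorffMeasure_sphere_lt_top hn hE
  simp only [LocIntOnHyp, hcast, hexp] at hk' hneg hnotint
  have hk : ContDiffOn ℝ 3 k (Ioi 0) := contDiffOn_profile_of_radial (m := 3) he hrad hW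
  have hk1 : ContDiffOn ℝ 2 (deriv k) (Ioi 0) :=
    ((contDiffOn_succ_iff_deriv_of_isOpen (n := 2) isOpen_Ioi).1 hk).2.2
  have hk2 : ContDiffOn ℝ 1 (deriv (deriv k)) (Ioi 0) :=
    ((contDiffOn_succ_iff_deriv_of_isOpen (n := 1) isOpen_Ioi).1 hk1).2.2
  have hd : ∀ {g : ℝ → ℝ} {m : WithTop ℕ∞}, m ≠ 0 → ContDiffOn ℝ m g (Ioi 0) →
      ∀ x, 0 < x → DifferentiableAt ℝ g x := fun hm hg x hx =>
    (hg.differentiableOn hm).differentiableAt (Ioi_mem_nhds hx)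
  have hf : ∀ x, 0 < x → HasDerivAt (deriv k) (deriv (deriv k) x) x := fun x hx =>
    (hd (by norm_num) hk1 x hx).hasDerivAt
  have hσ : 0 < (sphereArea (n + 1))⁻¹ := by
    rw [inv_pos, sphereArea, hcast]
    exact ENNReal.toReal_pos (hausdorffMeasure_sphere_pos hE he).ne' hfin.ne
  have hlim := (tendsto_neg_setIntegral_radialIntegrand hn hE he (measurable_deriv k)
    (measurable_deriv _) hf hk2.continuousOn hε hneg hk' hnotint hR).const_mul_atTop hσ
  refine hlim.congr' ?_
  have h1 : ∀ᶠ p : ℝ × ℝ in 𝓝 (R, R), 0 < p.1 :=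
    (continuous_fst.tendsto (R, R)).eventually (lt_mem_nhds hR)
  have h2 : ∀ᶠ p : ℝ × ℝ in 𝓝 (R, R), 0 < p.2 :=
    (continuous_snd.tendsto (R, R)).eventually (lt_mem_nhds hR)
  filter_upwards [self_mem_nhdsWithin, nhdsWithin_le_nhds h1, nhdsWithin_le_nhds h2]
    with p hne hr hη
  have hD := ((hasDerivAt_setIntegral_sphere_radial hE he hfin hf hk2.continuousOn hr hη
    hne).2.const_mul (-(sphereArea (n + 1))⁻¹))
  have hev : (fun s => omegaFun (n + 1) hN0 W s p.2) =ᶠ[𝓝 p.1] fun s =>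
      -(sphereArea (n + 1))⁻¹ * ∫ y in sphere (0 : Euc (n + 1)) 1,
        deriv k ‖s • e1 (n + 1) hN0 - p.2 • y‖ / ‖s • e1 (n + 1) hN0 - p.2 • y‖ *
          (s - p.2 * ⟪e1 (n + 1) hN0, y⟫) ∂μH[(n : ℝ)] := by
    filter_upwards [lt_mem_nhds hr, isOpen_ne.mem_nhds hne] with s hs hsne
    rw [omegaFun_eq_of_radial hN0 hrad (hd (by norm_num) hk) hs hη hsne, hcast]
  rw [(hD.congr_of_eventuallyEq hev).deriv]
  ring
end
end

section
/- Let N ≥ 2 and let W(x) = k(|x|) be a radially symmetric potential of class C¹ on ℝ^N∖{0} such that k' is locally integrable on hypersurfaces. Assume the potential is repulsive-attractive: there exists R_a > 0 such that k'(r) ≥ 0 for r > R_a and k'(r) < 0 for 0 < r < R_a. For r > 2R_a set Σ(r) = inf_{r/2 ≤ s ≤ 2r} k'(s) ≥ 0, and assume r^N Σ(r) → +∞ as r → ∞. Then there exists at least one R > 0 with ω(R,R) = 0; equivalently, the spherical shell δ_R is a steady state of the interaction equation, i.e. (∇W * δ_R)(x) = 0 for all x with |x| = R. -/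
open MeasureTheory Metric Set Filter
open scoped Topology RealInnerProductSpace

noncomputable section

/-- The spherical shell of radius R: the uniform probability measure on ∂B(0,R) ⊂ ℝ^N. -/
def shell (N : ℕ) (R : ℝ) : Measure (Euc N) :=
  (μH[(N:ℝ)-1] (sphere (0:Euc N) R))⁻¹ • (μH[(N:ℝ)-1]).restrict (sphere (0:Euc N) R)

open scoped ENNReal

section Zonal

variable {E : Type*} [NormedAddCommGroup E] [InnerProductSpace ℝ E]

lemma exists_linearIsometryEquiv_apply_eq {x y : E} (h : ‖x‖ = ‖y‖) :
    ∃ T : E ≃ₗᵢ[ℝ] E, T x = y :=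
  ⟨_, Submodule.reflection_sub h⟩

lemma norm_div_norm_smul {R : ℝ} (hR : 0 < R) {z : E} (hz : z ≠ 0) :
    ‖(R / ‖z‖) • z‖ = R := by
  have := norm_pos_iff.2 hz
  rw [norm_smul, Real.norm_of_nonneg (by positivity)]
  field_simp

variable [FiniteDimensional ℝ E] [MeasurableSpace E] [BorelSpace E]

lemma setLIntegral_ball_comp_isometry {F : Type*} [NormedAddCommGroup F] [InnerProductSpace ℝ F]
    [FiniteDimensional ℝ F] [MeasurableSpace F] [BorelSpace F] (T : E ≃ₗᵢ[ℝ] F) (f : ℝ → ℝ≥0∞)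
    (R : ℝ) (x : E) :
    ∫⁻ z in ball (0 : F) 1, f ‖T x - (R / ‖z‖) • z‖ =
      ∫⁻ z in ball (0 : E) 1, f ‖x - (R / ‖z‖) • z‖ := by
  have h := T.measurePreserving.setLIntegral_comp_preimage_emb
    T.toHomeomorph.measurableEmbedding (fun z => f ‖T x - (R / ‖z‖) • z‖) (ball (0 : F) 1)
  rw [← h]
  have hpre : T ⁻¹' ball (0 : F) 1 = ball 0 1 := by ext; simp
  rw [hpre]
  refine lintegral_congr fun z => ?_
  rw [T.norm_map, ← map_smul, ← map_sub, T.norm_map]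

/-- An isometry-invariant finite measure on a sphere has, up to a constant, the same zonal
integrals as the radial projection of Lebesgue measure on the unit ball. -/
lemma lintegral_zonal_eq [Nontrivial E] (μ : Measure E) [IsFiniteMeasure μ]
    (hinv : ∀ T : E ≃ₗᵢ[ℝ] E, μ.map T = μ) {R : ℝ} (hR : 0 < R) (hμ : ∀ᵐ y ∂μ, ‖y‖ = R)
    {x : E} (hx : ‖x‖ = R) {f : ℝ → ℝ≥0∞} (hf : Measurable f) :
    (∫⁻ y, f ‖x - y‖ ∂μ) * volume (ball (0 : E) 1) =
      μ univ * ∫⁻ z in ball (0 : E) 1, f ‖x - (R / ‖z‖) • z‖ := by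
  have hmeas : Measurable (Function.uncurry fun (z y : E) => f ‖(R / ‖z‖) • z - y‖) := by
    unfold Function.uncurry; fun_prop
  have hswap := lintegral_lintegral_swap (μ := volume.restrict (ball (0 : E) 1)) (ν := μ)
    hmeas.aemeasurable
  have h1 : ∀ᵐ z ∂(volume.restrict (ball (0 : E) 1)),
      ∫⁻ y, f ‖(R / ‖z‖) • z - y‖ ∂μ = ∫⁻ y, f ‖x - y‖ ∂μ := by
    have : ∀ᵐ z ∂(volume.restrict (ball (0 : E) 1)), z ≠ 0 :=
      ae_restrict_of_ae (Measure.ae_ne volume 0)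
    filter_upwards [this] with z hz
    obtain ⟨T, hT⟩ := exists_linearIsometryEquiv_apply_eq
      (hx.trans (norm_div_norm_smul hR hz).symm)
    rw [← hT]
    nth_rewrite 1 [← hinv T]
    rw [lintegral_map (by fun_prop) T.continuous.measurable]
    refine lintegral_congr fun y => ?_
    rw [← map_sub, T.norm_map]
  have h2 : ∀ᵐ y ∂μ, ∫⁻ z in ball (0 : E) 1, f ‖(R / ‖z‖) • z - y‖ =
      ∫⁻ z in ball (0 : E) 1, f ‖x - (R / ‖z‖) • z‖ := by
    filter_upwards [hμ] with y hy
    obtain ⟨T, hT⟩ := exists_linearIsometryEquiv_apply_eq (hx.trans hy.symm)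
    rw [← setLIntegral_ball_comp_isometry T, hT]
    simp_rw [norm_sub_rev y]
  rw [lintegral_congr_ae h1, lintegral_congr_ae h2] at hswap
  simp only [lintegral_const, Measure.restrict_apply_univ] at hswap
  rw [hswap, mul_comm]

end Zonal

lemma lintegral_fun_norm_volume {E : Type*} [NormedAddCommGroup E] [InnerProductSpace ℝ E]
    [FiniteDimensional ℝ E] [MeasurableSpace E] [BorelSpace E] [Nontrivial E]
    {f : ℝ → ℝ≥0∞} (hf : Measurable f) :
    ∫⁻ x : E, f ‖x‖ = (volume : Measure E).toSphere univ *
      ∫⁻ r in Ioi (0 : ℝ), ENNReal.ofReal (r ^ (Module.finrank ℝ E - 1)) * f r := by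
  have h := (volume : Measure E).measurePreserving_homeomorphUnitSphereProd.lintegral_comp_emb
    (Homeomorph.measurableEmbedding _) (fun p => f (p.2 : ℝ))
  simp only [homeomorphUnitSphereProd_apply_snd_coe] at h
  rw [lintegral_subtype_comap (measurableSet_singleton _).compl (fun x => f ‖x‖),
    restrict_compl_singleton] at h
  rw [h]
  have h2 := lintegral_prod_mul (μ := (volume : Measure E).toSphere)
    (ν := Measure.volumeIoiPow (Module.finrank ℝ E - 1)) (f := fun _ => 1)
    (g := fun r => f (r : ℝ)) (by fun_prop) (by fun_prop)
  simp only [one_mul, lintegral_one] at h2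
  rw [h2, Measure.volumeIoiPow, lintegral_withDensity_eq_lintegral_mul _ (by fun_prop)
    (by fun_prop)]
  congr 1
  exact lintegral_subtype_comap measurableSet_Ioi
    (fun r : ℝ => ENNReal.ofReal (r ^ (Module.finrank ℝ E - 1)) * f r)

lemma sqrt_two_sub_two_mul_cos {θ : ℝ} (h0 : 0 ≤ θ) (hπ : θ ≤ 2 * Real.pi) :
    √(2 - 2 * Real.cos θ) = 2 * Real.sin (θ / 2) := by
  have h : 2 - 2 * Real.cos θ = (2 * Real.sin (θ / 2)) ^ 2 := by
    rw [mul_pow, Real.sin_sq_eq_half_sub, mul_div_cancel₀ _ two_ne_zero]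
    ring
  rw [h, Real.sqrt_sq]
  have := Real.sin_nonneg_of_nonneg_of_le_pi (x := θ / 2) (by linarith) (by linarith)
  linarith

lemma norm_toLp_sub_smul {V : Type*} [NormedAddCommGroup V] [InnerProductSpace ℝ V] {R : ℝ}
    (hR : 0 < R) {z : WithLp 2 (ℝ × V)} (hz : z ≠ 0) :
    ‖WithLp.toLp 2 (R, (0 : V)) - (R / ‖z‖) • z‖ =
      R * √(2 - 2 * (z.fst / √(z.fst ^ 2 + ‖z.snd‖ ^ 2))) := by
  have hn := norm_pos_iff.2 hz
  have hsq := WithLp.prod_norm_sq_eq_of_L2 z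
  rw [Real.norm_eq_abs, sq_abs] at hsq
  rw [← hsq, Real.sqrt_sq hn.le, ← Real.sqrt_sq (norm_nonneg (_ - _)),
    WithLp.prod_norm_sq_eq_of_L2]
  have hfst : (WithLp.toLp 2 (R, (0 : V))).fst = R := rfl
  have hsnd : (WithLp.toLp 2 (R, (0 : V))).snd = 0 := rfl
  simp only [WithLp.sub_fst, WithLp.smul_fst, WithLp.sub_snd, WithLp.smul_snd, hfst, hsnd,
    zero_sub, norm_neg, norm_smul, smul_eq_mul, Real.norm_eq_abs, sq_abs, mul_pow]
  rw [← Real.sqrt_sq hR.le, ← Real.sqrt_mul (sq_nonneg _), Real.sqrt_sq hR.le]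
  congr 1
  field_simp
  linear_combination (-1 : ℝ) * hsq

/-- Zonal integrals of the radial projection of Lebesgue measure on the unit ball, in terms of
the polar angle. -/
lemma exists_lintegral_ball_zonal (m : ℕ) {R : ℝ} (hR : 0 < R) :
    ∃ C : ℝ≥0∞, ∀ f : ℝ → ℝ≥0∞, Measurable f →
      ∫⁻ z in ball (0 : WithLp 2 (ℝ × EuclideanSpace ℝ (Fin (m + 1)))) 1,
        f ‖WithLp.toLp 2 (R, 0) - (R / ‖z‖) • z‖ =
      C * ∫⁻ θ in Ioo 0 Real.pi,
        ENNReal.ofReal (Real.sin θ ^ m) * f (R * (2 * Real.sin (θ / 2))) := by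
  refine ⟨(volume : Measure (EuclideanSpace ℝ (Fin (m + 1)))).toSphere univ *
    ∫⁻ ρ in Ioi (0 : ℝ), (Iio 1).indicator (fun ρ => ENNReal.ofReal (ρ ^ (m + 1))) ρ,
    fun f hf => ?_⟩
  set G : ℝ → ℝ → ℝ≥0∞ := fun a r =>
    {p : ℝ × ℝ | p.1 ^ 2 + p.2 ^ 2 < 1}.indicator
      (fun p => f (R * √(2 - 2 * (p.1 / √(p.1 ^ 2 + p.2 ^ 2))))) (a, r) with hG
  have hset : MeasurableSet {p : ℝ × ℝ | p.1 ^ 2 + p.2 ^ 2 < 1} :=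
    measurableSet_lt (by fun_prop) (by fun_prop)
  have hGm : Measurable (Function.uncurry G) :=
    Measurable.indicator (by fun_prop) hset
  have hGm' : ∀ a, Measurable (G a) := fun a => hGm.comp (by fun_prop : Measurable fun r => (a, r))
  have h1 : ∫⁻ z in ball (0 : WithLp 2 (ℝ × EuclideanSpace ℝ (Fin (m + 1)))) 1,
        f ‖WithLp.toLp 2 (R, 0) - (R / ‖z‖) • z‖ =
      ∫⁻ z : WithLp 2 (ℝ × EuclideanSpace ℝ (Fin (m + 1))), G z.fst ‖z.snd‖ := by
    rw [← lintegral_indicator measurableSet_ball]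
    refine lintegral_congr_ae ?_
    have hnt : Nontrivial (WithLp 2 (ℝ × EuclideanSpace ℝ (Fin (m + 1)))) := inferInstance
    filter_upwards [Measure.ae_ne volume 0] with z hz
    have hsq := WithLp.prod_norm_sq_eq_of_L2 z
    rw [Real.norm_eq_abs, sq_abs] at hsq
    have hmem : z ∈ ball (0 : WithLp 2 (ℝ × EuclideanSpace ℝ (Fin (m + 1)))) 1 ↔
        (z.fst, ‖z.snd‖) ∈ {p : ℝ × ℝ | p.1 ^ 2 + p.2 ^ 2 < 1} := by
      rw [mem_ball_zero_iff, mem_ofPred_eq, ← hsq, sq_lt_one_iff₀ (norm_nonneg _)]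
    by_cases h : z ∈ ball (0 : WithLp 2 (ℝ × EuclideanSpace ℝ (Fin (m + 1)))) 1
    · rw [indicator_of_mem h, hG]
      simp only
      rw [indicator_of_mem (hmem.1 h), norm_toLp_sub_smul hR hz]
    · rw [indicator_of_notMem h, hG]
      simp only
      rw [indicator_of_notMem (hmem.not.1 h)]
  have hGn : Measurable fun p : ℝ × EuclideanSpace ℝ (Fin (m + 1)) => G p.1 ‖p.2‖ :=
    hGm.comp (by fun_prop : Measurable fun p : ℝ × EuclideanSpace ℝ (Fin (m + 1)) => (p.1, ‖p.2‖))
  have h2 := (WithLp.volume_preserving_ofLp ℝ (EuclideanSpace ℝ (Fin (m + 1)))).lintegral_comp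
    hGn
  set H : ℝ × ℝ → ℝ≥0∞ := fun p =>
    {p : ℝ × ℝ | 0 < p.2}.indicator (fun p => ENNReal.ofReal (p.2 ^ m) * G p.1 p.2) p with hH
  have hHm : Measurable H := Measurable.indicator (Measurable.mul (by fun_prop) hGm)
    (measurableSet_lt (by fun_prop) (by fun_prop))
  have h3 : ∀ a, ∫⁻ b : EuclideanSpace ℝ (Fin (m + 1)), G a ‖b‖ =
      (volume : Measure (EuclideanSpace ℝ (Fin (m + 1)))).toSphere univ * ∫⁻ r, H (a, r) := by
    intro a
    rw [lintegral_fun_norm_volume (hGm' a), finrank_euclideanSpace_fin, Nat.add_sub_cancel,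
      ← lintegral_indicator measurableSet_Ioi]
    rfl
  rw [h1]
  refine h2.trans ?_
  rw [Measure.volume_eq_prod, lintegral_prod _ hGn.aemeasurable]
  simp_rw [h3]
  rw [lintegral_const_mul _ (by exact hHm.lintegral_prod_right'), ← lintegral_prod _ hHm.aemeasurable,
    ← Measure.volume_eq_prod, ← lintegral_comp_polarCoord_symm, polarCoord_target, mul_assoc]
  congr 1
  rw [Measure.volume_eq_prod, ← Measure.prod_restrict]
  have h4 : (∫⁻ θ in Ioo 0 Real.pi,
      ENNReal.ofReal (Real.sin θ ^ m) * f (R * (2 * Real.sin (θ / 2)))) =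
      ∫⁻ θ in Ioo (-Real.pi) Real.pi, (Ioi 0).indicator (fun θ =>
      ENNReal.ofReal (Real.sin θ ^ m) * f (R * (2 * Real.sin (θ / 2)))) θ := by
    rw [lintegral_indicator measurableSet_Ioi, Measure.restrict_restrict measurableSet_Ioi,
      Ioi_inter_Ioo, max_eq_left (by linarith [Real.pi_pos])]
  rw [h4, ← lintegral_prod_mul]
  · rw [Measure.prod_restrict]
    refine setLIntegral_congr_fun (measurableSet_Ioi.prod measurableSet_Ioo) ?_
    rintro ⟨ρ, θ⟩ ⟨hρ, hθ⟩
    simp only [mem_Ioi, mem_Ioo] at hρ hθ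
    simp only [polarCoord_symm_apply, smul_eq_mul, hH, indicator, mem_ofPred_eq, mem_Ioi,
      mem_Iio]
    rcases lt_or_ge 0 θ with h | h
    · have hs := Real.sin_pos_of_pos_of_lt_pi h hθ.2
      have hsum : (ρ * Real.cos θ) ^ 2 + (ρ * Real.sin θ) ^ 2 = ρ ^ 2 := by
        linear_combination ρ ^ 2 * Real.sin_sq_add_cos_sq θ
      have hq : ρ * Real.cos θ / ρ = Real.cos θ := by field_simp
      rw [if_pos (by positivity), if_pos h]
      simp only [hG, indicator, mem_ofPred_eq, hsum, Real.sqrt_sq hρ.le, hq,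
        sq_lt_one_iff₀ hρ.le, sqrt_two_sub_two_mul_cos h.le (by linarith [hθ.2, Real.pi_pos])]
      split_ifs
      · rw [mul_pow, ENNReal.ofReal_mul (by positivity), pow_succ', ENNReal.ofReal_mul hρ.le]
        ring
      · simp
    · have hs := Real.sin_nonpos_of_nonpos_of_neg_pi_le h hθ.1.le
      rw [if_neg (by nlinarith), if_neg h.not_gt]
      simp
  · exact (Measurable.indicator (by fun_prop) measurableSet_Iio).aemeasurable
  · exact (Measurable.indicator (by fun_prop) measurableSet_Ioi).aemeasurable

/-- Zonal integrals of an isometry-invariant finite measure on a sphere, in terms of the polar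
angle. -/
lemma exists_integral_zonal {m : ℕ} (μ : Measure (EuclideanSpace ℝ (Fin (m + 2))))
    [IsFiniteMeasure μ]
    (hinv : ∀ T : EuclideanSpace ℝ (Fin (m + 2)) ≃ₗᵢ[ℝ] EuclideanSpace ℝ (Fin (m + 2)),
      μ.map T = μ)
    {R : ℝ} (hR : 0 < R) (hμ : ∀ᵐ y ∂μ, ‖y‖ = R) :
    ∃ C : ℝ, ∀ g : ℝ → ℝ, Measurable g → ∀ x, ‖x‖ = R →
      ∫ y, g ‖x - y‖ ∂μ = C * ∫ θ in Ioo 0 Real.pi,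
        Real.sin θ ^ m * g (R * (2 * Real.sin (θ / 2))) := by
  obtain ⟨C, hC⟩ := exists_lintegral_ball_zonal m hR
  set v := volume (ball (0 : EuclideanSpace ℝ (Fin (m + 2))) 1) with hv
  have hv0 : v ≠ 0 := (measure_ball_pos volume _ one_pos).ne'
  have hvt : v ≠ ⊤ := measure_ball_lt_top.ne
  set ρ : Measure ℝ := (volume.restrict (Ioo 0 Real.pi)).withDensity
    (fun θ => ENNReal.ofReal (Real.sin θ ^ m)) with hρ
  have hmR : Measurable fun θ => R * (2 * Real.sin (θ / 2)) := by fun_prop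
  have hsm : Measurable fun θ => ENNReal.ofReal (Real.sin θ ^ m) := by fun_prop
  have hmap : ∀ x : EuclideanSpace ℝ (Fin (m + 2)), ‖x‖ = R → μ.map (fun y => ‖x - y‖) =
      (μ univ * C / v) • ρ.map (fun θ => R * (2 * Real.sin (θ / 2))) := by
    intro x hx
    refine Measure.ext_of_lintegral _ fun f hf => ?_
    rw [lintegral_map hf (by fun_prop), lintegral_smul_measure, lintegral_map hf hmR,
      hρ, lintegral_withDensity_eq_lintegral_mul _ hsm (show Measurable
      fun θ => f (R * (2 * Real.sin (θ / 2))) from hf.comp hmR)]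
    have h1 := lintegral_zonal_eq μ hinv hR hμ hx hf
    have hfin : Module.finrank ℝ (EuclideanSpace ℝ (Fin (m + 2))) =
        Module.finrank ℝ (WithLp 2 (ℝ × EuclideanSpace ℝ (Fin (m + 1)))) := by
      rw [(WithLp.linearEquiv 2 ℝ (ℝ × EuclideanSpace ℝ (Fin (m + 1)))).finrank_eq,
        Module.finrank_prod]
      simp
      ring
    let T₀ := ((stdOrthonormalBasis ℝ (EuclideanSpace ℝ (Fin (m + 2)))).reindex
      (finCongr hfin)).equiv (stdOrthonormalBasis ℝ (WithLp 2 (ℝ × EuclideanSpace ℝ (Fin (m + 1)))))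
      (Equiv.refl _)
    have hnorm : ‖T₀ x‖ = ‖WithLp.toLp 2 (R, (0 : EuclideanSpace ℝ (Fin (m + 1))))‖ := by
      rw [T₀.norm_map, hx, WithLp.prod_norm_eq_of_L2]
      simp [Real.sqrt_sq hR.le]
    obtain ⟨T₁, hT₁⟩ := exists_linearIsometryEquiv_apply_eq hnorm
    rw [← setLIntegral_ball_comp_isometry (T₀.trans T₁), LinearIsometryEquiv.trans_apply, hT₁,
      hC f hf] at h1
    rw [(ENNReal.eq_div_iff hv0 hvt).2 ((mul_comm _ _).trans h1)]
    simp only [Pi.mul_apply, smul_eq_mul, div_eq_mul_inv]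
    ring
  refine ⟨(μ univ * C / v).toReal, fun g hg x hx => ?_⟩
  have h := congrArg (fun ν => ∫ s, g s ∂ν) (hmap x hx)
  rw [integral_map (by fun_prop) hg.aestronglyMeasurable, integral_smul_measure,
    integral_map hmR.aemeasurable hg.aestronglyMeasurable] at h
  rw [h, smul_eq_mul]
  congr 1
  rw [hρ]
  refine (integral_withDensity_eq_integral_smul (f := fun θ => Real.toNNReal (Real.sin θ ^ m))
    (by fun_prop) _).trans ?_
  refine setIntegral_congr_fun measurableSet_Ioo fun θ hθ => ?_
  simp only [NNReal.smul_def, smul_eq_mul]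
  rw [Real.coe_toNNReal _ (pow_nonneg (Real.sin_pos_of_pos_of_lt_pi hθ.1 hθ.2).le _)]

section Radial

variable {E : Type*} [NormedAddCommGroup E] [InnerProductSpace ℝ E]
  {W : E → ℝ} {k : ℝ → ℝ}

lemma contDiffOn_radial_profile [Nontrivial E] (hrad : ∀ x, W x = k ‖x‖)
    (hW : ContDiffOn ℝ 1 W {(0 : E)}ᶜ) : ContDiffOn ℝ 1 k (Ioi 0) := by
  obtain ⟨e, he⟩ := exists_norm_eq E zero_le_one
  have he0 : e ≠ 0 := by rintro rfl; simp at he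
  have h : ContDiffOn ℝ 1 (fun t : ℝ => W (t • e)) (Ioi 0) :=
    hW.comp (by fun_prop) fun t (ht : 0 < t) => by simp [he0, ht.ne']
  refine h.congr fun t (ht : 0 < t) => ?_
  rw [hrad, norm_smul, he, mul_one, Real.norm_of_nonneg ht.le]

lemma gradient_radial [CompleteSpace E] (hrad : ∀ x, W x = k ‖x‖)
    (hk : ContDiffOn ℝ 1 k (Ioi 0)) (x : E) :
    gradient W x = (deriv k ‖x‖ / ‖x‖) • x := by
  rcases eq_or_ne x 0 with rfl | hx
  · have h : fderiv ℝ W 0 = 0 := by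
      have h1 := fderiv_comp_smul (f := W) (x := 0) (-1 : ℝ)
      have h2 : (fun x => W ((-1 : ℝ) • x)) = W := by
        ext x
        rw [hrad, hrad, neg_one_smul, norm_neg]
      rw [h2, smul_zero, neg_one_smul] at h1
      ext v
      have h3 := DFunLike.congr_fun h1 v
      simp only [neg_apply] at h3
      rw [zero_apply]
      linarith
    simp [gradient, h]
  · have hn := norm_pos_iff.2 hx
    have hk' : HasDerivAt k (deriv k ‖x‖) ‖x‖ :=
      ((hk.differentiableOn one_ne_zero).differentiableAt (Ioi_mem_nhds hn)).hasDerivAt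
    have hnorm : HasFDerivAt (fun y : E => ‖y‖) ((1 / (2 * ‖x‖)) • (2 • innerSL ℝ x)) x := by
      have h := (hasStrictFDerivAt_norm_sq x).hasFDerivAt.sqrt (by positivity)
      simpa only [Real.sqrt_sq (norm_nonneg _)] using h
    have h := hk'.comp_hasFDerivAt x hnorm
    have hWe : W = k ∘ fun y => ‖y‖ := funext hrad
    rw [← hWe] at h
    refine HasGradientAt.gradient ?_
    rw [hasGradientAt_iff_hasFDerivAt]
    convert! h using 1
    ext y
    simp
    field_simp

lemma inner_sub_left_self_of_norm_eq {x y : E} (h : ‖x‖ = ‖y‖) :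
    ⟪x - y, x⟫ = ‖x - y‖ ^ 2 / 2 := by
  rw [norm_sub_sq_real, inner_sub_left, real_inner_self_eq_norm_sq, ← h, real_inner_comm]
  ring

lemma inner_gradient_radial [CompleteSpace E] (hrad : ∀ x, W x = k ‖x‖)
    (hk : ContDiffOn ℝ 1 k (Ioi 0)) {x y : E} (h : ‖x‖ = ‖y‖) :
    ⟪gradient W (x - y), x⟫ = deriv k ‖x - y‖ * (‖x - y‖ / 2) := by
  rw [gradient_radial hrad hk, real_inner_smul_left, inner_sub_left_self_of_norm_eq h]
  rcases eq_or_ne ‖x - y‖ 0 with h0 | h0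
  · simp [h0]
  · field_simp

variable [MeasurableSpace E] [BorelSpace E]

/-- By symmetry, the interaction field of an invariant measure is radial. -/
lemma integral_gradient_eq_zero [FiniteDimensional ℝ E] (hrad : ∀ x, W x = k ‖x‖)
    (hk : ContDiffOn ℝ 1 k (Ioi 0)) (μ : Measure E) (hinv : ∀ T : E ≃ₗᵢ[ℝ] E, μ.map T = μ)
    {x : E} (hx : x ≠ 0) (h0 : ∫ y, ⟪gradient W (x - y), x⟫ ∂μ = 0) :
    ∫ y, gradient W (x - y) ∂μ = 0 := by
  by_cases hint : Integrable (fun y => gradient W (x - y)) μ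
  swap
  · exact integral_undef hint
  set V := ∫ y, gradient W (x - y) ∂μ with hV
  let T : E ≃ₗᵢ[ℝ] E := Submodule.reflection (ℝ ∙ x)
  have hTx : T x = x := Submodule.reflection_mem_subspace_eq_self
    (Submodule.mem_span_singleton_self x)
  have hTV : T V = V := by
    have h1 : T V = ∫ y, T (gradient W (x - y)) ∂μ :=
      (T.toContinuousLinearEquiv.integral_comp_comm _).symm
    have h2 : ∀ y, T (gradient W (x - y)) = gradient W (x - T y) := fun y => by
      rw [gradient_radial hrad hk, gradient_radial hrad hk, map_smul, map_sub, hTx]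
      nth_rewrite 4 5 [← hTx]
      rw [← map_sub, T.norm_map]
    rw [h1]
    simp_rw [h2]
    rw [hV]
    conv_rhs => rw [← hinv T]
    exact (T.toHomeomorph.measurableEmbedding.integral_map (fun y => gradient W (x - y))).symm
  obtain ⟨a, ha⟩ := Submodule.mem_span_singleton.1 ((Submodule.reflection_eq_self_iff V).1 hTV)
  have h3 : ⟪V, x⟫ = 0 := by
    rw [← h0, real_inner_comm, ← integral_inner hint]
    simp_rw [real_inner_comm x]
  rw [← ha, real_inner_smul_left, real_inner_self_eq_norm_sq] at h3
  have := norm_pos_iff.2 hx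
  have ha0 : a = 0 := by
    rcases mul_eq_zero.1 h3 with h | h
    · exact h
    · exact absurd h (by positivity)
  rw [← ha, ha0, zero_smul]

lemma map_restrict_hausdorffMeasure_sphere (d r : ℝ) (T : E ≃ₗᵢ[ℝ] E) :
    ((μH[d]).restrict (sphere (0 : E) r)).map T = (μH[d]).restrict (sphere (0 : E) r) := by
  have hpre : T ⁻¹' sphere (0 : E) r = sphere 0 r := by ext; simp
  have h := Measure.restrict_map (μ := μH[d]) T.continuous.measurable
    (isClosed_sphere (x := (0 : E)) (ε := r)).measurableSet
  rw [hpre, show (μH[d]).map T = μH[d] from T.toIsometryEquiv.map_hausdorffMeasure d] at h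
  exact h.symm

end Radial

section Profile

variable {m : ℕ} {p K : ℝ → ℝ}

lemma integrableOn_profile (hp : ContinuousOn p (Ioi 0))
    (hint : IntegrableOn (fun r => |p r| * r ^ m) (Ioo 0 1)) (T : ℝ) :
    IntegrableOn (fun r => p r * r ^ (m + 1)) (Ioo 0 T) := by
  have h1 : IntegrableOn (fun r => p r * r ^ (m + 1)) (Ioo 0 1) := by
    refine Integrable.mono' hint ?_ ?_
    · exact ((hp.mono Ioo_subset_Ioi_self).mul (by fun_prop)).aestronglyMeasurable
        measurableSet_Ioo
    · refine (ae_restrict_mem measurableSet_Ioo).mono fun r hr => ?_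
      rw [Real.norm_eq_abs, abs_mul, abs_of_nonneg (pow_nonneg hr.1.le _)]
      exact mul_le_mul_of_nonneg_left (pow_le_pow_of_le_one hr.1.le hr.2.le m.le_succ)
        (abs_nonneg _)
  have h2 : IntegrableOn (fun r => p r * r ^ (m + 1)) (Icc 1 T) :=
    ((hp.mono fun r hr => zero_lt_one.trans_le hr.1).mul (by fun_prop)).integrableOn_Icc
  refine (h1.union h2).mono_set fun r hr => ?_
  rcases lt_or_ge r 1 with h | h
  · exact Or.inl ⟨hr.1, h⟩
  · exact Or.inr ⟨h, hr.2.le⟩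

lemma setIntegral_Ioo_comp_mul_left (f : ℝ → ℝ) {R : ℝ} (hR : 0 < R) (a : ℝ) :
    ∫ v in Ioo 0 a, f (R * v) = R⁻¹ * ∫ u in Ioo 0 (R * a), f u := by
  have h := integral_image_eq_integral_abs_deriv_smul (s := Ioo 0 a) (f := fun v => R * v)
    (f' := fun _ => R) measurableSet_Ioo
    (fun v _ => by simpa using ((hasDerivAt_id v).const_mul R).hasDerivWithinAt)
    (fun a _ b _ hab => mul_left_cancel₀ hR.ne' hab) f
  rw [image_mul_left_Ioo hR, mul_zero] at h
  rw [h]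
  simp only [smul_eq_mul, abs_of_pos hR, integral_const_mul]
  field_simp

lemma integrableOn_Ioo_comp_mul_left_iff (f : ℝ → ℝ) {R : ℝ} (hR : 0 < R) (a : ℝ) :
    IntegrableOn (fun v => f (R * v)) (Ioo 0 a) ↔ IntegrableOn f (Ioo 0 (R * a)) := by
  have h := integrableOn_image_iff_integrableOn_abs_deriv_smul (s := Ioo 0 a)
    (f := fun v => R * v) (f' := fun _ => R) measurableSet_Ioo
    (fun v _ => by simpa using ((hasDerivAt_id v).const_mul R).hasDerivWithinAt)
    (fun a _ b _ hab => mul_left_cancel₀ hR.ne' hab) f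
  rw [image_mul_left_Ioo hR, mul_zero] at h
  rw [h]
  simp only [smul_eq_mul, abs_of_pos hR]
  exact (integrable_const_mul_iff (IsUnit.mk0 R hR.ne') _).symm

lemma continuous_truncated (hp : ContinuousOn p (Ioi 0)) {ε : ℝ} (hε : 0 < ε) :
    Continuous fun u => p (max u ε) :=
  continuousOn_univ.1 (hp.comp (by fun_prop) fun _ _ => hε.trans_le (le_max_right _ _))

lemma continuousAt_integral_truncated (hp : ContinuousOn p (Ioi 0))
    (hK : IntegrableOn K (Ioo 0 1)) {ε R₀ : ℝ} (hε : 0 < ε) (hR₀ : 0 < R₀) :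
    ContinuousAt (fun R => ∫ v in Ioo 0 1, p (max (R * v) ε) * v ^ (m + 1) * K v) R₀ := by
  have hpc := continuous_truncated hp hε
  obtain ⟨B, hB⟩ := (isCompact_Icc (a := (0 : ℝ)) (b := R₀ + 1)).exists_bound_of_continuousOn
    hpc.continuousOn
  refine continuousAt_of_dominated (bound := fun v => B * |K v|) ?_ ?_ (hK.abs.const_mul B) ?_
  · refine Eventually.of_forall fun R => AEStronglyMeasurable.mul ?_ hK.aestronglyMeasurable
    exact (Continuous.mul (hpc.comp (by fun_prop)) (by fun_prop)).aestronglyMeasurable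
  · filter_upwards [Ioo_mem_nhds hR₀ (lt_add_one R₀)] with R hR
    refine (ae_restrict_mem measurableSet_Ioo).mono fun v hv => ?_
    have h1 := hB (R * v) ⟨by nlinarith [hR.1, hv.1], by nlinarith [hR.1, hR.2, hv.1, hv.2]⟩
    rw [norm_mul, norm_mul, Real.norm_eq_abs (K v)]
    refine mul_le_mul_of_nonneg_right ?_ (abs_nonneg _)
    have h2 : ‖v ^ (m + 1)‖ ≤ 1 := by
      rw [Real.norm_of_nonneg (pow_nonneg hv.1.le _)]
      exact pow_le_one₀ hv.1.le hv.2.le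
    calc _ ≤ B * 1 := mul_le_mul h1 h2 (norm_nonneg _) ((norm_nonneg _).trans h1)
      _ = B := mul_one B
  · refine Eventually.of_forall fun v => Continuous.continuousAt ?_
    exact ((hpc.comp (by fun_prop)).mul continuous_const).mul continuous_const

lemma integrableOn_truncated (hp : ContinuousOn p (Ioi 0))
    (hK : IntegrableOn K (Ioo 0 1)) {ε : ℝ} (hε : 0 < ε) (R : ℝ) :
    IntegrableOn (fun v => p (max (R * v) ε) * v ^ (m + 1) * K v) (Ioo 0 1) := by
  have hpc : Continuous fun v => p (max (R * v) ε) * v ^ (m + 1) :=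
    ((continuous_truncated hp hε).comp (by fun_prop)).mul (by fun_prop)
  obtain ⟨B, hB⟩ := (isCompact_Icc (a := (0 : ℝ)) (b := 1)).exists_bound_of_continuousOn
    hpc.continuousOn
  refine Integrable.bdd_mul (c := B) hK hpc.aestronglyMeasurable ?_
  exact (ae_restrict_mem measurableSet_Ioo).mono fun v hv => hB v (Ioo_subset_Icc_self hv)

lemma comp_mul_eq_scaled {R : ℝ} (hR : 0 < R) (h : ℝ → ℝ) (v : ℝ) :
    h (R * v) * v ^ (m + 1) * K v =
      (R ^ (m + 1))⁻¹ * (h (R * v) * (R * v) ^ (m + 1) * K (R * v / R)) := by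
  rw [mul_div_cancel_left₀ _ hR.ne', mul_pow]
  field_simp

/-- The part of the profile supported in `(0, ε)`. -/
lemma singular_part (hKc : ContinuousOn K (Icc 0 (1 / 2))) {h : ℝ → ℝ} {ε : ℝ}
    (hε : 0 < ε) (hint : IntegrableOn (fun u => h u * u ^ (m + 1)) (Ioo 0 ε))
    (hsupp : ∀ u, ε ≤ u → h u = 0) {R : ℝ} (hR : 2 * ε < R) :
    IntegrableOn (fun v => h (R * v) * v ^ (m + 1) * K v) (Ioo 0 1) ∧
    ∫ v in Ioo 0 1, h (R * v) * v ^ (m + 1) * K v =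
      (R ^ (m + 2))⁻¹ * ∫ u in Ioo 0 ε, h u * u ^ (m + 1) * K (u / R) := by
  have hR0 : 0 < R := by linarith
  have hz : ∀ u ∈ Ioo 0 R \ Ioo 0 ε, h u * u ^ (m + 1) * K (u / R) = 0 := by
    rintro u ⟨hu, hu'⟩
    rw [hsupp u (not_lt.1 fun h => hu' ⟨hu.1, h⟩), zero_mul, zero_mul]
  have hsub : Ioo 0 ε ⊆ Ioo 0 R := Ioo_subset_Ioo_right (by linarith)
  obtain ⟨B, hB⟩ := isCompact_Icc.exists_bound_of_continuousOn hKc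
  have hmaps : MapsTo (fun u => u / R) (Ioo 0 ε) (Icc 0 (1 / 2)) := fun u hu => by
    refine ⟨div_nonneg hu.1.le hR0.le, ?_⟩
    rw [div_le_iff₀ hR0]
    linarith [hu.2]
  have hi : IntegrableOn (fun u => h u * u ^ (m + 1) * K (u / R)) (Ioo 0 ε) := by
    refine Integrable.mul_bdd (c := B) hint ?_ ?_
    · exact (hKc.comp (by fun_prop) hmaps).aestronglyMeasurable measurableSet_Ioo
    · exact (ae_restrict_mem measurableSet_Ioo).mono fun u hu => hB _ (hmaps hu)
  have hi' : IntegrableOn (fun u => h u * u ^ (m + 1) * K (u / R)) (Ioo 0 R) :=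
    hi.of_forall_sdiff_eq_zero measurableSet_Ioo hz
  simp_rw [comp_mul_eq_scaled (K := K) (m := m) hR0 h]
  refine ⟨Integrable.const_mul ((integrableOn_Ioo_comp_mul_left_iff
    (fun u => h u * u ^ (m + 1) * K (u / R)) hR0 1).2 (by rwa [mul_one])) _, ?_⟩
  rw [integral_const_mul, setIntegral_Ioo_comp_mul_left
    (fun u => h u * u ^ (m + 1) * K (u / R)) hR0 1, mul_one,
    setIntegral_eq_of_subset_of_forall_sdiff_eq_zero measurableSet_Ioo hsub hz, pow_succ R (m + 1),
    mul_inv]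
  ring

lemma continuousAt_singular_part (hKc : ContinuousOn K (Icc 0 (1 / 2))) {h : ℝ → ℝ} {ε : ℝ}
    (hε : 0 < ε) (hint : IntegrableOn (fun u => h u * u ^ (m + 1)) (Ioo 0 ε))
    (hsupp : ∀ u, ε ≤ u → h u = 0) {R₀ : ℝ} (hR₀ : 2 * ε < R₀) :
    ContinuousAt (fun R => ∫ v in Ioo 0 1, h (R * v) * v ^ (m + 1) * K v) R₀ := by
  have hR0 : 0 < R₀ := by linarith
  obtain ⟨B, hB⟩ := isCompact_Icc.exists_bound_of_continuousOn hKc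
  have hmem : ∀ {R u : ℝ}, 2 * ε < R → u ∈ Ioo 0 ε → u / R ∈ Ioo 0 (1 / 2) := fun {R u} hR hu => by
    have : 0 < R := by linarith
    refine ⟨div_pos hu.1 this, ?_⟩
    rw [div_lt_iff₀ this]
    linarith [hu.2]
  have hev : ∀ᶠ R in 𝓝 R₀, 2 * ε < R := lt_mem_nhds hR₀
  have hmain : ContinuousAt (fun R => (R ^ (m + 2))⁻¹ *
      ∫ u in Ioo 0 ε, h u * u ^ (m + 1) * K (u / R)) R₀ := by
    refine ContinuousAt.mul (ContinuousAt.inv₀ (by fun_prop) (by positivity)) ?_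
    refine continuousAt_of_dominated (bound := fun u => |h u * u ^ (m + 1)| * B) ?_ ?_
      (hint.abs.mul_const B) ?_
    · filter_upwards [hev] with R hR
      refine hint.aestronglyMeasurable.mul ?_
      exact (hKc.comp (by fun_prop) fun u hu =>
        Ioo_subset_Icc_self (hmem hR hu)).aestronglyMeasurable measurableSet_Ioo
    · filter_upwards [hev] with R hR
      refine (ae_restrict_mem measurableSet_Ioo).mono fun u hu => ?_
      rw [norm_mul, Real.norm_eq_abs]
      exact mul_le_mul_of_nonneg_left (hB _ (Ioo_subset_Icc_self (hmem hR hu))) (abs_nonneg _)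
    · refine (ae_restrict_mem measurableSet_Ioo).mono fun u hu => ?_
      refine continuousAt_const.mul ?_
      have hKat : ContinuousAt K (u / R₀) := hKc.continuousAt
        (Icc_mem_nhds (hmem hR₀ hu).1 (hmem hR₀ hu).2)
      exact ContinuousAt.comp (g := K) (f := fun R => u / R) hKat
        (continuousAt_const.div continuousAt_id hR0.ne')
  refine hmain.congr ?_
  filter_upwards [hev] with R hR
  exact (singular_part hKc hε hint hsupp hR).2.symm

lemma profile_continuousAt_integrable (hp : ContinuousOn p (Ioi 0))
    (hint : IntegrableOn (fun r => |p r| * r ^ m) (Ioo 0 1))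
    (hK : IntegrableOn K (Ioo 0 1)) (hKc : ContinuousOn K (Icc 0 (1 / 2)))
    {R₀ : ℝ} (hR₀ : 0 < R₀) :
    IntegrableOn (fun v => p (R₀ * v) * v ^ (m + 1) * K v) (Ioo 0 1) ∧
    ContinuousAt (fun R => ∫ v in Ioo 0 1, p (R * v) * v ^ (m + 1) * K v) R₀ := by
  set ε := R₀ / 4 with hε_def
  have hε : 0 < ε := by positivity
  have hεR : 2 * ε < R₀ := by rw [hε_def]; linarith
  set h : ℝ → ℝ := fun u => p u - p (max u ε) with hh
  have hsupp : ∀ u, ε ≤ u → h u = 0 := fun u hu => by simp [hh, max_eq_left hu]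
  have hhint : IntegrableOn (fun u => h u * u ^ (m + 1)) (Ioo 0 ε) := by
    have h1 : IntegrableOn (fun u => p ε * u ^ (m + 1)) (Ioo 0 ε) :=
      (Continuous.integrableOn_Icc (by fun_prop)).mono_set Ioo_subset_Icc_self
    refine ((integrableOn_profile hp hint ε).sub h1).congr_fun ?_ measurableSet_Ioo
    intro u hu
    simp only [hh, Pi.sub_apply, max_eq_right hu.2.le]
    ring
  have hsum : ∀ R v, p (R * v) * v ^ (m + 1) * K v = p (max (R * v) ε) * v ^ (m + 1) * K v +
      h (R * v) * v ^ (m + 1) * K v := fun R v => by simp only [hh]; ring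
  refine ⟨?_, ?_⟩
  · simp_rw [hsum]
    exact (integrableOn_truncated hp hK hε R₀).add (singular_part hKc hε hhint hsupp hεR).1
  · refine ((continuousAt_integral_truncated (m := m) hp hK hε hR₀).add
      (continuousAt_singular_part hKc hε hhint hsupp hεR)).congr ?_
    filter_upwards [lt_mem_nhds hεR] with R hR
    simp_rw [hsum]
    exact (integral_add (integrableOn_truncated hp hK hε R)
      (singular_part hKc hε hhint hsupp hR).1).symm

lemma profile_integral_lower_bound (hp : ContinuousOn p (Ioi 0))
    (hint : IntegrableOn (fun r => |p r| * r ^ m) (Ioo 0 1))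
    (hK : IntegrableOn K (Ioo 0 1)) (hKc : ContinuousOn K (Icc 0 (1 / 2)))
    (hKpos : ∀ v ∈ Ioo (0 : ℝ) 1, 0 < K v) {Ra : ℝ} (hRa : 0 < Ra)
    (hattr : ∀ r, Ra < r → 0 ≤ p r) :
    ∃ D : ℝ, ∀ R, 4 * Ra < R →
      R ^ (m + 2) * sInf (p '' Icc (R / 2) (2 * R)) *
        (∫ v in Ioo (1 / 2) 1, v ^ (m + 1) * K v) - D ≤
      R ^ (m + 2) * ∫ v in Ioo 0 1, p (R * v) * v ^ (m + 1) * K v := by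
  have hε : 0 < 2 * Ra := by positivity
  set h : ℝ → ℝ := (Iio (2 * Ra)).indicator fun u => |p u| with hh
  have hsupp : ∀ u, 2 * Ra ≤ u → h u = 0 := fun u hu => indicator_of_notMem (by simpa using hu) _
  have h0 : ∀ u, 0 ≤ h u := fun u => indicator_nonneg (fun _ _ => abs_nonneg _) _
  have hhint : IntegrableOn (fun u => h u * u ^ (m + 1)) (Ioo 0 (2 * Ra)) := by
    refine IntegrableOn.congr_fun (f := fun u => |p u * u ^ (m + 1)|)
      (integrableOn_profile hp hint (2 * Ra)).abs ?_ measurableSet_Ioo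
    intro u hu
    simp only [hh, indicator_of_mem (mem_Iio.2 hu.2), abs_mul, abs_of_nonneg (pow_nonneg hu.1.le _)]
  obtain ⟨B, hB⟩ := isCompact_Icc.exists_bound_of_continuousOn hKc
  refine ⟨(∫ u in Ioo 0 (2 * Ra), h u * u ^ (m + 1)) * B, fun R hR => ?_⟩
  have hR0 : 0 < R := by linarith
  set S := sInf (p '' Icc (R / 2) (2 * R)) with hS
  have hbdd : BddBelow (p '' Icc (R / 2) (2 * R)) := by
    refine ⟨0, ?_⟩
    rintro _ ⟨r, hr, rfl⟩
    exact hattr r (by linarith [hr.1])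
  obtain ⟨hsi, hse⟩ := singular_part hKc hε hhint hsupp (R := R) (by linarith)
  have hKi : IntegrableOn (fun v => v ^ (m + 1) * K v) (Ioo 0 1) := by
    refine Integrable.bdd_mul (c := 1) hK (by fun_prop) ?_
    refine (ae_restrict_mem measurableSet_Ioo).mono fun v hv => ?_
    rw [Real.norm_of_nonneg (pow_nonneg hv.1.le _)]
    exact pow_le_one₀ hv.1.le hv.2.le
  have hindi : IntegrableOn ((Ioi (1 / 2)).indicator fun v => S * (v ^ (m + 1) * K v))
      (Ioo 0 1) := (hKi.const_mul S).indicator measurableSet_Ioi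
  have hindv : ∫ v in Ioo 0 1, (Ioi (1 / 2)).indicator (fun v => S * (v ^ (m + 1) * K v)) v =
      S * ∫ v in Ioo (1 / 2) 1, v ^ (m + 1) * K v := by
    rw [setIntegral_indicator measurableSet_Ioi, Ioo_inter_Ioi, max_eq_right (by norm_num),
      integral_const_mul]
  have hmono : ∫ v in Ioo 0 1, ((Ioi (1 / 2)).indicator (fun v => S * (v ^ (m + 1) * K v)) v -
      h (R * v) * v ^ (m + 1) * K v) ≤ ∫ v in Ioo 0 1, p (R * v) * v ^ (m + 1) * K v := by
    refine setIntegral_mono_on (hindi.sub hsi)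
      (profile_continuousAt_integrable hp hint hK hKc hR0).1 measurableSet_Ioo fun v hv => ?_
    have hw : 0 ≤ v ^ (m + 1) * K v := mul_nonneg (pow_nonneg hv.1.le _) (hKpos v hv).le
    rw [mul_assoc, mul_assoc]
    rcases lt_or_ge (1 / 2) v with h1 | h1
    · rw [indicator_of_mem (mem_Ioi.2 h1), hsupp _ (by nlinarith), zero_mul, sub_zero]
      refine mul_le_mul_of_nonneg_right (csInf_le hbdd (mem_image_of_mem p ⟨?_, ?_⟩)) hw
      · nlinarith
      · nlinarith [hv.2]
    · rw [indicator_of_notMem (by simpa using h1), zero_sub, ← neg_mul]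
      refine mul_le_mul_of_nonneg_right ?_ hw
      rcases lt_or_ge (R * v) (2 * Ra) with h2 | h2
      · rw [hh, indicator_of_mem (mem_Iio.2 h2)]
        exact neg_abs_le _
      · rw [hsupp _ h2, neg_zero]
        exact hattr _ (by linarith)
  rw [integral_sub hindi hsi, hindv, hse] at hmono
  have hD : ∫ u in Ioo 0 (2 * Ra), h u * u ^ (m + 1) * K (u / R) ≤
      (∫ u in Ioo 0 (2 * Ra), h u * u ^ (m + 1)) * B := by
    rw [← integral_mul_const]
    refine integral_mono_of_nonneg ?_ (hhint.mul_const B) ?_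
    all_goals
      refine (ae_restrict_mem measurableSet_Ioo).mono fun u hu => ?_
      have hw : 0 ≤ h u * u ^ (m + 1) := mul_nonneg (h0 u) (pow_nonneg hu.1.le _)
      have hu0 : 0 < u / R := div_pos hu.1 hR0
      have hu1 : u / R ≤ 1 / 2 := by
        rw [div_le_iff₀ hR0]
        linarith [hu.2]
    · exact mul_nonneg hw (hKpos _ ⟨hu0, by linarith⟩).le
    · exact mul_le_mul_of_nonneg_left ((le_abs_self _).trans (hB _ ⟨hu0.le, hu1⟩)) hw
  have hpow : 0 < R ^ (m + 2) := by positivity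
  have hfin := mul_le_mul_of_nonneg_left hmono hpow.le
  rw [mul_sub, mul_inv_cancel_left₀ hpow.ne', ← mul_assoc] at hfin
  linarith

/-- A repulsive-attractive profile has a scale at which its weighted average vanishes. -/
lemma exists_profile_integral_eq_zero (hp : ContinuousOn p (Ioi 0))
    (hint : IntegrableOn (fun r => |p r| * r ^ m) (Ioo 0 1))
    (hK : IntegrableOn K (Ioo 0 1)) (hKc : ContinuousOn K (Icc 0 (1 / 2)))
    (hKpos : ∀ v ∈ Ioo (0 : ℝ) 1, 0 < K v) {Ra : ℝ} (hRa : 0 < Ra)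
    (hattr : ∀ r, Ra < r → 0 ≤ p r) (hrep : ∀ r, 0 < r → r < Ra → p r < 0)
    (hSigma : Tendsto (fun r : ℝ => r ^ (m + 2) * sInf (p '' Icc (r / 2) (2 * r))) atTop atTop) :
    ∃ R > 0, ∫ v in Ioo 0 1, p (R * v) * v ^ (m + 1) * K v = 0 := by
  obtain ⟨D, hD⟩ := profile_integral_lower_bound hp hint hK hKc hKpos hRa hattr
  set c := ∫ v in Ioo (1 / 2) 1, v ^ (m + 1) * K v with hc
  have hsub : Ioo (1 / 2 : ℝ) 1 ⊆ Ioo 0 1 := Ioo_subset_Ioo_left (by norm_num)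
  have hcpos : 0 < c := by
    have hKi : IntegrableOn (fun v => v ^ (m + 1) * K v) (Ioo (1 / 2) 1) := by
      refine Integrable.bdd_mul (c := 1) (hK.mono_set hsub) (by fun_prop) ?_
      refine (ae_restrict_mem measurableSet_Ioo).mono fun v hv => ?_
      rw [Real.norm_of_nonneg (pow_nonneg (hsub hv).1.le _)]
      exact pow_le_one₀ (hsub hv).1.le hv.2.le
    have hpos : ∀ v ∈ Ioo (1 / 2 : ℝ) 1, 0 < v ^ (m + 1) * K v := fun v hv =>
      mul_pos (pow_pos (hsub hv).1 _) (hKpos v (hsub hv))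
    have hss : Ioo (1 / 2 : ℝ) 1 ⊆ Function.support fun v => v ^ (m + 1) * K v :=
      fun v hv => (hpos v hv).ne'
    rw [hc, setIntegral_pos_iff_support_of_nonneg_ae
      ((ae_restrict_mem measurableSet_Ioo).mono fun v hv => (hpos v hv).le) hKi,
      inter_eq_right.2 hss]
    simp
    norm_num
  obtain ⟨R₁, hR₁, hR₁'⟩ := ((hSigma.eventually_ge_atTop (D / c)).and
    (eventually_gt_atTop (4 * Ra))).exists
  have hR₁0 : 0 < R₁ := by linarith
  have hneg : ∫ v in Ioo 0 1, p (Ra * v) * v ^ (m + 1) * K v ≤ 0 :=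
    setIntegral_nonpos measurableSet_Ioo fun v hv =>
      mul_nonpos_of_nonpos_of_nonneg (mul_nonpos_of_nonpos_of_nonneg
        (hrep _ (mul_pos hRa hv.1) (mul_lt_of_lt_one_right hRa hv.2)).le (pow_nonneg hv.1.le _))
        (hKpos v hv).le
  have hpos : 0 ≤ ∫ v in Ioo 0 1, p (R₁ * v) * v ^ (m + 1) * K v := by
    have h1 := hD R₁ hR₁'
    rw [div_le_iff₀ hcpos] at hR₁
    exact nonneg_of_mul_nonneg_right ((sub_nonneg.2 hR₁).trans h1) (by positivity)
  exact isPreconnected_Ioi.intermediate_value₂ (mem_Ioi.2 hRa) (mem_Ioi.2 hR₁0)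
    (fun R hR => (profile_continuousAt_integrable hp hint hK hKc hR).2.continuousWithinAt)
    continuousOn_const hneg hpos

end Profile

section Angle

lemma image_two_mul_arcsin_Ioo :
    (fun v => 2 * Real.arcsin v) '' Ioo 0 1 = Ioo 0 Real.pi := by
  ext θ
  constructor
  · rintro ⟨v, hv, rfl⟩
    have h1 := Real.arcsin_pos.2 hv.1
    have h2 := Real.arcsin_lt_pi_div_two.2 hv.2
    exact ⟨by positivity, by linarith⟩
  · intro hθ
    have h1 := Real.sin_pos_of_pos_of_lt_pi (x := θ / 2) (by linarith [hθ.1])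
      (by linarith [hθ.1, hθ.2])
    have h3 : Real.arcsin (Real.sin (θ / 2)) = θ / 2 :=
      Real.arcsin_sin (by linarith [hθ.1, Real.pi_pos]) (by linarith [hθ.2])
    refine ⟨Real.sin (θ / 2), ⟨h1, ?_⟩, ?_⟩
    · rw [← Real.arcsin_lt_pi_div_two, h3]
      linarith [hθ.2]
    · simp only [h3]
      ring

lemma hasDerivWithinAt_two_mul_arcsin {v : ℝ} (hv : v ∈ Ioo (0 : ℝ) 1) :
    HasDerivWithinAt (fun v => 2 * Real.arcsin v) (2 * (1 / √(1 - v ^ 2))) (Ioo 0 1) v :=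
  ((Real.hasDerivAt_arcsin (by linarith [hv.1]) hv.2.ne).const_mul 2).hasDerivWithinAt

lemma injOn_two_mul_arcsin : InjOn (fun v => 2 * Real.arcsin v) (Ioo 0 1) := fun a ha b hb hab =>
  Real.injOn_arcsin ⟨by linarith [ha.1], ha.2.le⟩ ⟨by linarith [hb.1], hb.2.le⟩
    (mul_left_cancel₀ two_ne_zero hab)

lemma sin_two_mul_arcsin {v : ℝ} (hv : v ∈ Ioo (0 : ℝ) 1) :
    Real.sin (2 * Real.arcsin v) = 2 * v * √(1 - v ^ 2) := by
  rw [Real.sin_two_mul, Real.cos_arcsin, Real.sin_arcsin (by linarith [hv.1]) hv.2.le]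

lemma integral_angle_eq (m : ℕ) (p : ℝ → ℝ) (R : ℝ) :
    ∫ θ in Ioo 0 Real.pi, Real.sin θ ^ m *
        (p (R * (2 * Real.sin (θ / 2))) * Real.sin (θ / 2)) =
      2 ^ (m + 1) * ∫ v in Ioo 0 1, p (2 * R * v) * v ^ (m + 1) *
        (√(1 - v ^ 2) ^ m * (1 / √(1 - v ^ 2))) := by
  rw [← image_two_mul_arcsin_Ioo, integral_image_eq_integral_abs_deriv_smul measurableSet_Ioo
    (fun v hv => hasDerivWithinAt_two_mul_arcsin hv) injOn_two_mul_arcsin, ← integral_const_mul]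
  refine setIntegral_congr_fun measurableSet_Ioo fun v hv => ?_
  have hs : 0 ≤ √(1 - v ^ 2) := Real.sqrt_nonneg _
  simp only [sin_two_mul_arcsin hv, smul_eq_mul, mul_div_cancel_left₀ _ (two_ne_zero' ℝ),
    Real.sin_arcsin (by linarith [hv.1] : -1 ≤ v) hv.2.le]
  rw [abs_of_nonneg (by positivity), show R * (2 * v) = 2 * R * v by ring]
  ring

lemma integrableOn_angle_weight (m : ℕ) :
    IntegrableOn (fun v : ℝ => √(1 - v ^ 2) ^ m * (1 / √(1 - v ^ 2))) (Ioo 0 1) := by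
  have h := (integrableOn_image_iff_integrableOn_abs_deriv_smul measurableSet_Ioo
    (fun v hv => hasDerivWithinAt_two_mul_arcsin hv) injOn_two_mul_arcsin
    (fun _ => (1 / 2 : ℝ))).1 (by
      rw [image_two_mul_arcsin_Ioo]
      exact integrableOn_const (by simp))
  have h' : IntegrableOn (fun v : ℝ => 1 / √(1 - v ^ 2)) (Ioo 0 1) := by
    refine h.congr_fun (fun v _ => ?_) measurableSet_Ioo
    have hs : 0 ≤ √(1 - v ^ 2) := Real.sqrt_nonneg _
    simp only [smul_eq_mul]
    rw [abs_of_nonneg (by positivity)]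
    ring
  refine Integrable.bdd_mul (c := 1) h' (by fun_prop) (Eventually.of_forall fun v => ?_)
  rw [Real.norm_of_nonneg (by positivity)]
  exact pow_le_one₀ (Real.sqrt_nonneg _) (Real.sqrt_le_one.2 (by nlinarith))

lemma exists_angle_integral_eq_zero {m : ℕ} {p : ℝ → ℝ} (hp : ContinuousOn p (Ioi 0))
    (hint : IntegrableOn (fun r => |p r| * r ^ m) (Ioo 0 1)) {Ra : ℝ} (hRa : 0 < Ra)
    (hattr : ∀ r, Ra < r → 0 ≤ p r) (hrep : ∀ r, 0 < r → r < Ra → p r < 0)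
    (hSigma : Tendsto (fun r : ℝ => r ^ (m + 2) * sInf (p '' Icc (r / 2) (2 * r))) atTop atTop) :
    ∃ R > 0, ∫ θ in Ioo 0 Real.pi, Real.sin θ ^ m *
        (p (R * (2 * Real.sin (θ / 2))) * Real.sin (θ / 2)) = 0 := by
  have hpos : ∀ v ∈ Ico (0 : ℝ) 1, 0 < √(1 - v ^ 2) := fun v hv =>
    Real.sqrt_pos.2 (by nlinarith [hv.1, hv.2])
  obtain ⟨R, hR, h0⟩ := exists_profile_integral_eq_zero hp hint (integrableOn_angle_weight m)
    (ContinuousOn.mul (by fun_prop) (ContinuousOn.div (by fun_prop) (by fun_prop)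
      fun v hv => (hpos v ⟨hv.1, by linarith [hv.2]⟩).ne'))
    (fun v hv => by have := hpos v ⟨hv.1.le, hv.2⟩; positivity) hRa hattr hrep hSigma
  refine ⟨R / 2, by positivity, ?_⟩
  rw [integral_angle_eq, mul_div_cancel₀ _ two_ne_zero, h0, mul_zero]

end Angle

section Shell

variable {m : ℕ} {W : Euc (m + 2) → ℝ} {k : ℝ → ℝ}

lemma integral_inner_gradient_eq_zero (hrad : ∀ x, W x = k ‖x‖)
    (hk : ContDiffOn ℝ 1 k (Ioi 0)) {c r : ℝ} (hc : 0 < c) (hr : 0 < r)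
    (hJ : ∫ θ in Ioo 0 Real.pi, Real.sin θ ^ m *
      (deriv k (c * r * (2 * Real.sin (θ / 2))) * Real.sin (θ / 2)) = 0)
    (μ : Measure (Euc (m + 2))) [IsFiniteMeasure μ]
    (hinv : ∀ T : Euc (m + 2) ≃ₗᵢ[ℝ] Euc (m + 2), μ.map T = μ) (hμ : ∀ᵐ y ∂μ, ‖y‖ = r)
    {x : Euc (m + 2)} (hx : ‖x‖ = r) :
    ∫ y, ⟪gradient W (c • x - c • y), x⟫ ∂μ = 0 := by
  obtain ⟨C, hC⟩ := exists_integral_zonal μ hinv hr hμ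
  have hg : Measurable fun s => deriv k (c * s) * (s / 2) :=
    ((measurable_deriv k).comp (measurable_const_mul c)).mul (measurable_id.div_const 2)
  have hcongr : ∀ᵐ y ∂μ, ⟪gradient W (c • x - c • y), x⟫ =
      deriv k (c * ‖x - y‖) * (‖x - y‖ / 2) := hμ.mono fun y hy => by
    have h := inner_gradient_radial hrad hk (x := c • x) (y := c • y)
      (by rw [norm_smul, norm_smul, hx, hy])
    rw [real_inner_smul_right, ← smul_sub, norm_smul, Real.norm_of_nonneg hc.le,
      mul_div_assoc, mul_left_comm] at h
    rw [← smul_sub]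
    exact mul_left_cancel₀ hc.ne' h
  rw [integral_congr_ae hcongr, hC _ hg x hx]
  have hθ : ∀ θ : ℝ, Real.sin θ ^ m * (deriv k (c * (r * (2 * Real.sin (θ / 2)))) *
      (r * (2 * Real.sin (θ / 2)) / 2)) = r * (Real.sin θ ^ m *
      (deriv k (c * r * (2 * Real.sin (θ / 2))) * Real.sin (θ / 2))) := fun θ => by
    rw [← mul_assoc c r]
    ring
  simp_rw [hθ]
  rw [integral_const_mul, hJ, mul_zero, mul_zero]

lemma ae_norm_eq_restrict_sphere {E : Type*} [NormedAddCommGroup E] [MeasurableSpace E]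
    [BorelSpace E] (μ : Measure E) (r : ℝ) : ∀ᵐ y ∂μ.restrict (sphere (0 : E) r), ‖y‖ = r :=
  (ae_restrict_mem isClosed_sphere.measurableSet).mono fun _ hy => mem_sphere_zero_iff_norm.1 hy

lemma omegaFun_eq_zero (hN : 0 < m + 2) (hrad : ∀ x, W x = k ‖x‖)
    (hk : ContDiffOn ℝ 1 k (Ioi 0)) {R : ℝ} (hR : 0 < R)
    (hJ : ∫ θ in Ioo 0 Real.pi, Real.sin θ ^ m *
      (deriv k (R * (2 * Real.sin (θ / 2))) * Real.sin (θ / 2)) = 0) :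
    omegaFun (m + 2) hN W R R = 0 := by
  unfold omegaFun sphereArea
  by_cases htop : μH[((m + 2 : ℕ) : ℝ) - 1] (sphere (0 : Euc (m + 2)) 1) = ⊤
  · rw [htop, ENNReal.toReal_top, inv_zero, neg_zero, zero_mul]
  · have := isFiniteMeasure_restrict.2 htop
    rw [integral_inner_gradient_eq_zero hrad hk hR one_pos (by rwa [mul_one]) _
      (map_restrict_hausdorffMeasure_sphere _ _) (ae_norm_eq_restrict_sphere _ _)
      (by simp [e1]), mul_zero]

lemma integral_gradient_shell_eq_zero (hrad : ∀ x, W x = k ‖x‖)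
    (hk : ContDiffOn ℝ 1 k (Ioi 0)) {R : ℝ} (hR : 0 < R)
    (hJ : ∫ θ in Ioo 0 Real.pi, Real.sin θ ^ m *
      (deriv k (R * (2 * Real.sin (θ / 2))) * Real.sin (θ / 2)) = 0)
    {x : Euc (m + 2)} (hx : ‖x‖ = R) :
    ∫ y, gradient W (x - y) ∂(shell (m + 2) R) = 0 := by
  unfold shell
  by_cases htop : μH[((m + 2 : ℕ) : ℝ) - 1] (sphere (0 : Euc (m + 2)) R) = ⊤
  · rw [htop, ENNReal.inv_top, zero_smul, integral_zero_measure]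
  · have := isFiniteMeasure_restrict.2 htop
    have hinv := map_restrict_hausdorffMeasure_sphere (E := Euc (m + 2))
      (((m + 2 : ℕ) : ℝ) - 1) R
    have h0 := integral_inner_gradient_eq_zero hrad hk one_pos hR (by rwa [one_mul]) _ hinv
      (ae_norm_eq_restrict_sphere _ _) hx
    simp_rw [one_smul] at h0
    have hx0 : x ≠ 0 := norm_pos_iff.1 (hx ▸ hR)
    rw [integral_smul_measure, integral_gradient_eq_zero hrad hk _ hinv hx0 h0, smul_zero]

end Shell

/-- Existence of spherical shell steady states for repulsive-attractive potentials whose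
attractive strength does not decay faster than 1/r^N at infinity. -/
theorem exists_shell_steady_state (N : ℕ) (hN : 2 ≤ N) (W : Euc N → ℝ) (k : ℝ → ℝ)
    (hrad : ∀ x, W x = k ‖x‖)
    (hW : ContDiffOn ℝ 1 W {(0 : Euc N)}ᶜ)
    (hk' : LocIntOnHyp N (deriv k))
    (Ra : ℝ) (hRa : 0 < Ra)
    (hattr : ∀ r, Ra < r → 0 ≤ deriv k r)
    (hrep : ∀ r, 0 < r → r < Ra → deriv k r < 0)
    (hSigma : Tendsto (fun r : ℝ => r ^ N * sInf (deriv k '' Icc (r/2) (2*r)))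
      atTop atTop) :
    ∃ R > 0, omegaFun N (by omega) W R R = 0 ∧
      ∀ x : Euc N, ‖x‖ = R → (∫ y, gradient W (x - y) ∂(shell N R)) = 0 := by
  obtain ⟨m, rfl⟩ : ∃ m, N = m + 2 := ⟨N - 2, by omega⟩
  have hk := contDiffOn_radial_profile hrad hW
  obtain ⟨R, hR, hJ⟩ := exists_angle_integral_eq_zero
    (hk.continuousOn_deriv_of_isOpen isOpen_Ioi le_rfl) hk' hRa hattr hrep hSigma
  exact ⟨R, hR, omegaFun_eq_zero _ hrad hk hR hJ,
    fun x hx => integral_gradient_shell_eq_zero hrad hk hR hJ hx⟩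
end
end
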